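/- arXiv:math/0409317 — 2 statements merged into one kernel-verified Lean document; each statement's English description precedes it below -/
import Mathlib

section
/- Let ω ∈ Ω be a percolation configuration and x ∈ ℤ^d be such that V(x) is finite. If s, t ∈ V₁(x) and s↔t in ω, then there exists an open path from s to t all of whose vertices lie in V₂(x). -/
open MeasureTheory Filter
open scoped ENNReal

namespace ChemDist

/-- Vertices of the lattice `ℤ^d`. -/
abbrev Vert (d : ℕ) := Fin d → ℤ

/-- Nearest-neighbour adjacency on `ℤ^d`: `‖x - y‖₁ = 1`. -/
def adj {d : ℕ} (x y : Vert d) : Prop := (∑ i, |x i - y i|) = 1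

/-- The edge set `𝔼^d`, as a predicate on unordered pairs. -/
def IsEdge {d : ℕ} (e : Sym2 (Vert d)) : Prop := ∃ x y : Vert d, adj x y ∧ e = s(x, y)

/-- The type of edges of `ℤ^d`. -/
abbrev EdgeT (d : ℕ) := {e : Sym2 (Vert d) // IsEdge e}

/-- Percolation configurations: `Ω = {0,1}^{𝔼^d}`. -/
abbrev Config (d : ℕ) := EdgeT d → Bool

/-- `P` is the product Bernoulli measure with parameter `p` over the index `ι`. -/
def IsProductBernoulli {ι : Type*} (p : ℝ) (P : Measure (ι → Bool)) : Prop :=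
  IsProbabilityMeasure P ∧
    ∀ (s : Finset ι) (η : ι → Bool),
      P {ω | ∀ e ∈ s, ω e = η e} =
        ∏ e ∈ s, (if η e then ENNReal.ofReal p else ENNReal.ofReal (1 - p))

/-- The edge between adjacent `x` and `y` is open in `ω`. -/
def edgeOpen {d : ℕ} (ω : Config d) (x y : Vert d) : Prop :=
  ∃ h : adj x y, ω ⟨s(x, y), x, y, h, rfl⟩ = true

/-- The chemical distance `D(x,y)(ω)`: minimal number of edges of an open path from `x`
to `y`, and `+∞` if there is no such path. -/
noncomputable def chemDist {d : ℕ} (ω : Config d) (x y : Vert d) : ℕ∞ :=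
  sInf {n : ℕ∞ | ∃ l : List (Vert d),
    List.Chain (edgeOpen ω) x l ∧ (x :: l).getLast (by simp) = y ∧ n = l.length}

/-- Real-valued version of the chemical distance (with value `0` when infinite). -/
noncomputable def chemDistR {d : ℕ} (ω : Config d) (x y : Vert d) : ℝ :=
  ((chemDist ω x y).toNat : ℝ)

/-- `x ↔ y` : `x` and `y` are in the same open cluster. -/
def Conn {d : ℕ} (ω : Config d) (x y : Vert d) : Prop := chemDist ω x y ≠ ⊤

/-- The open cluster of `x`. -/
def cluster {d : ℕ} (ω : Config d) (x : Vert d) : Set (Vert d) := {y | Conn ω x y}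

/-- `x ↔ ∞`. -/
def InfCluster {d : ℕ} (ω : Config d) (x : Vert d) : Prop := (cluster ω x).Infinite

/-- The critical probability `p_c(d)` of Bernoulli bond percolation on `ℤ^d`. -/
noncomputable def pc (d : ℕ) : ℝ :=
  sInf {p : ℝ | p ∈ Set.Icc (0 : ℝ) 1 ∧
    ∀ P : Measure (Config d), IsProductBernoulli p P → 0 < P {ω | InfCluster ω 0}}

/-- The `ℓ¹` norm on `ℝ^d`. -/
noncomputable def nrm1 {d : ℕ} (x : Fin d → ℝ) : ℝ := ∑ i, |x i|

/-- The Euclidean norm on `ℝ^d`. -/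
noncomputable def nrm2 {d : ℕ} (x : Fin d → ℝ) : ℝ := Real.sqrt (∑ i, (x i) ^ 2)

/-- Canonical embedding `ℤ^d → ℝ^d`. -/
def toR {d : ℕ} (x : Vert d) : Fin d → ℝ := fun i => (x i : ℝ)

/-- `μ` is a norm on `ℝ^d`. -/
structure IsNorm {d : ℕ} (μ : (Fin d → ℝ) → ℝ) : Prop where
  add_le : ∀ x y, μ (x + y) ≤ μ x + μ y
  smul : ∀ (c : ℝ) (x), μ (c • x) = |c| * μ x
  eq_zero_iff : ∀ x, μ x = 0 ↔ x = 0

/-- `μ` is the time constant (Garet–Marchand norm) of the chemical distance at parameter `p`: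
it is a norm, and `ℙ_p`-a.s. on `{0 ↔ ∞}`, for every `u ∈ ℤ^d∖{0}` the set
`{k > 0 : ku ↔ ∞}` is infinite and `D(0, T_{n,u} u)/T_{n,u} → μ(u)` where `T_{·,u}` is its
increasing enumeration. -/
def TimeConstant (d : ℕ) (p : ℝ) (μ : (Fin d → ℝ) → ℝ) : Prop :=
  IsNorm μ ∧
  ∀ P : Measure (Config d), IsProductBernoulli p P →
    ∀ᵐ ω ∂P, InfCluster ω 0 →
      ∀ u : Vert d, u ≠ 0 →
        {k : ℕ | 0 < k ∧ InfCluster ω (k • u)}.Infinite ∧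
        Tendsto (fun n : ℕ =>
            chemDistR ω 0 ((Nat.nth (fun k => 0 < k ∧ InfCluster ω (k • u)) n) • u) /
              (Nat.nth (fun k => 0 < k ∧ InfCluster ω (k • u)) n))
          atTop (nhds (μ (toR u)))


/-- `x` is wired in `ω`: every edge with both endpoints within `ℓ^∞` distance `1`
of `x` is open. -/
def Wired {d : ℕ} (ω : Config d) (x : Vert d) : Prop :=
  ∀ s t : Vert d, adj s t → (∀ i, |s i - x i| ≤ 1) → (∀ i, |t i - x i| ≤ 1) →
    edgeOpen ω s t

/-- `*`-adjacency: `‖a - b‖_∞ = 1`. -/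
def starAdj {d : ℕ} (a b : Vert d) : Prop := a ≠ b ∧ ∀ i, |a i - b i| ≤ 1

/-- `V(x)`: the set of vertices joined to `x` by a `*`-path of unwired vertices
(empty when `x` is wired). -/
def Vset {d : ℕ} (ω : Config d) (x : Vert d) : Set (Vert d) :=
  {y | ¬ Wired ω x ∧
    Relation.ReflTransGen (fun a b => ¬ Wired ω b ∧ starAdj a b) x y}

/-- `V₁(x) = V(x) + {-1,0,1}^d`. -/
def V1 {d : ℕ} (ω : Config d) (x : Vert d) : Set (Vert d) :=
  {z | ∃ v ∈ Vset ω x, ∀ i, |z i - v i| ≤ 1}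

/-- `V₂(x) = V₁(x) + {-1,0,1}^d`. -/
def V2 {d : ℕ} (ω : Config d) (x : Vert d) : Set (Vert d) :=
  {z | ∃ v ∈ V1 ω x, ∀ i, |z i - v i| ≤ 1}

/-- Two vertices are near if they are at `ℓ^∞` distance at most `1`. -/
def Near {d : ℕ} (u v : Vert d) : Prop := ∀ i, |u i - v i| ≤ 1

lemma Near.symm {d : ℕ} {u v : Vert d} (h : Near u v) : Near v u := fun i => by
  rw [abs_sub_comm]; exact h i

lemma Near.refl {d : ℕ} (u : Vert d) : Near u u := fun i => by simp

lemma adj.near {d : ℕ} {u v : Vert d} (h : adj u v) : Near u v := fun i => by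
  rw [← show (∑ i, |u i - v i|) = 1 from h]
  exact Finset.single_le_sum (f := fun i => |u i - v i|) (fun _ _ => abs_nonneg _)
    (Finset.mem_univ i)

/-- Move every nonzero coordinate one step towards the origin. -/
def retract {d : ℕ} (u : Vert d) : Vert d :=
  fun i => if 0 < u i then u i - 1 else if u i < 0 then u i + 1 else 0

/-- The sum of `f` along the first `n` steps of the retraction of `u` to the origin. -/
def retractSum {d : ℕ} (f : Vert d → Vert d → ℤ) : ℕ → Vert d → ℤ
  | 0, _ => 0
  | n + 1, u => f u (retract u) + retractSum f n (retract u)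

lemma abs_retract_le {d : ℕ} {n : ℕ} {u : Vert d} (hu : ∀ i, |u i| ≤ (n + 1 : ℕ)) (i : Fin d) :
    |retract u i| ≤ n := by
  have := hu i
  simp only [retract]
  grind

/-- A closed `1`-cochain on the clique complex of the `ℓ^∞` lattice satisfies the homotopy
identity for the retraction. -/
lemma cochain_eq_retract {d : ℕ} {f : Vert d → Vert d → ℤ}
    (hf : ∀ u v w, Near u v → Near v w → Near u w → f u v + f v w = f u w)
    {u v : Vert d} (h : Near u v) :
    Near (retract u) (retract v) ∧
      f u v = f u (retract u) + f (retract u) (retract v) - f v (retract v) := by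
  set w : Vert d := fun i => if |u i| ≤ |v i| then u i else v i
  have huw : Near u w := fun i => by have := h i; simp only [w]; grind
  have hwv : Near w v := fun i => by have := h i; simp only [w]; grind
  have huru : Near u (retract u) := fun i => by simp only [retract]; grind
  have hvrv : Near v (retract v) := fun i => by simp only [retract]; grind
  have hruw : Near (retract u) w := fun i => by
    have := h i; simp only [w, retract]; grind
  have hwrv : Near w (retract v) := fun i => by
    have := h i; simp only [w, retract]; grind
  have hrr : Near (retract u) (retract v) := fun i => by
    have := h i; simp only [retract]; grind
  refine ⟨hrr, ?_⟩
  linarith [hf u w v huw hwv h, hf u (retract u) w huru hruw huw,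
    hf w v (retract v) hwv hvrv hwrv, hf (retract u) w (retract v) hruw hwrv hrr]

lemma cochain_eq_retractSum_sub {d : ℕ} {f : Vert d → Vert d → ℤ}
    (hf : ∀ u v w, Near u v → Near v w → Near u w → f u v + f v w = f u w) (n : ℕ)
    {u v : Vert d} (hu : ∀ i, |u i| ≤ n) (hv : ∀ i, |v i| ≤ n) (h : Near u v) :
    f u v = retractSum f n u - retractSum f n v := by
  induction n generalizing u v with
  | zero =>
    have huv : u = v := funext fun i => by have := hu i; have := hv i; grind
    subst huv
    have := hf u u u h h h
    simp only [retractSum]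
    linarith
  | succ n ih =>
    obtain ⟨hr, he⟩ := cochain_eq_retract hf h
    rw [he, ih (abs_retract_le hu) (abs_retract_le hv) hr]
    simp only [retractSum]
    ring

/-- Closed `1`-cochains on the clique complex of the `ℓ^∞` lattice are exact. -/
lemma exists_potential {d : ℕ} {f : Vert d → Vert d → ℤ}
    (hf : ∀ u v w, Near u v → Near v w → Near u w → f u v + f v w = f u w) :
    ∃ g : Vert d → ℤ, ∀ u v, Near u v → f u v = g u - g v := by
  have hstep : ∀ (n : ℕ) (u : Vert d), (∀ i, |u i| ≤ n) →
      retractSum f (n + 1) u = retractSum f n u := by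
    intro n
    induction n with
    | zero =>
      intro u hu
      have hur : retract u = u := funext fun i => by have := hu i; simp only [retract]; grind
      have := hf u u u (Near.refl u) (Near.refl u) (Near.refl u)
      simp only [retractSum, hur]
      linarith
    | succ n ih =>
      intro u hu
      rw [retractSum, ih _ (abs_retract_le hu), ← retractSum]
  have hstable : ∀ (u : Vert d) (n m : ℕ), (∀ i, |u i| ≤ n) → n ≤ m →
      retractSum f m u = retractSum f n u := by
    intro u n m hu hnm
    induction m, hnm using Nat.le_induction with
    | base => rfl
    | succ m hm ih => rw [hstep m u fun i => (hu i).trans (by exact_mod_cast hm), ih]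
  let N : Vert d → ℕ := fun u => ∑ i, (u i).natAbs
  have hN : ∀ (u : Vert d) i, |u i| ≤ N u := fun u i => by
    rw [Int.abs_eq_natAbs]
    exact_mod_cast Finset.single_le_sum (f := fun i => (u i).natAbs) (fun _ _ => Nat.zero_le _)
      (Finset.mem_univ i)
  refine ⟨fun u => retractSum f (N u) u, fun u v h => ?_⟩
  have hu : ∀ i, |u i| ≤ (max (N u) (N v) : ℕ) := fun i =>
    (hN u i).trans (by exact_mod_cast le_max_left _ _)
  have hv : ∀ i, |v i| ≤ (max (N u) (N v) : ℕ) := fun i =>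
    (hN v i).trans (by exact_mod_cast le_max_right _ _)
  rw [cochain_eq_retractSum_sub hf _ hu hv h, hstable u _ _ (hN u) (le_max_left _ _),
    hstable v _ _ (hN v) (le_max_right _ _)]

/-- The inner boundary, towards a component `D` of the complement, of a `*`-connected set `A` is
`*`-connected. Connectedness of a set is expressed as constancy of the functions that
are constant on near pairs of the set. -/
lemma boundary_connected {d : ℕ} {A D : Set (Vert d)}
    (hA : ∀ g : Vert d → ℤ, (∀ u ∈ A, ∀ v ∈ A, Near u v → g u = g v) →
      ∀ u ∈ A, ∀ v ∈ A, g u = g v)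
    (hD : ∀ g : Vert d → ℤ, (∀ u ∈ D, ∀ v ∈ D, Near u v → g u = g v) →
      ∀ u ∈ D, ∀ v ∈ D, g u = g v)
    (hAD : Disjoint A D) (hclosed : ∀ u ∈ D, ∀ v, Near u v → v ∉ A → v ∈ D)
    {a b u u' : Vert d} (ha : a ∈ A) (hb : b ∈ A) (hu : u ∈ D) (hu' : u' ∈ D)
    (hua : Near u a) (hub : Near u' b) :
    Relation.ReflTransGen (fun p q => Near p q ∧ q ∈ A ∧ ∃ y ∈ D, Near y q) a b := by
  classical
  rw [Set.disjoint_left] at hAD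
  set W : Set (Vert d) := {w | w ∈ A ∧
    Relation.ReflTransGen (fun p q => Near p q ∧ q ∈ A ∧ ∃ y ∈ D, Near y q) a w}
  have hWA : ∀ w ∈ W, w ∈ A := fun w hw => hw.1
  have hWstep : ∀ y ∈ D, ∀ w ∈ W, ∀ z, Near y z → Near w z → z ∉ D → z ∈ W := by
    intro y hy w hw z hyz hwz hz
    have hzA : z ∈ A := by
      by_contra hzA
      exact hz (hclosed y hy z hyz hzA)
    exact ⟨hzA, hw.2.tail ⟨hwz, hzA, y, hy, hyz⟩⟩
  obtain ⟨g, hg⟩ := exists_potential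
    (f := fun p q : Vert d => if p ∈ D ∧ q ∈ W then 1 else if q ∈ D ∧ p ∈ W then -1 else 0) (by
      intro p q r hpq hqr hpr
      have key : ∀ y z w : Vert d, Near y z → Near w z → y ∈ D → w ∈ W → z ∉ D → z ∈ W :=
        fun y z w h₁ h₂ h₃ h₄ h₅ => hWstep y h₃ w h₄ z h₁ h₂ h₅
      have h₁ := key p q r hpq hqr.symm
      have h₂ := key r q p hqr.symm hpq
      have h₃ := key p r q hpr hqr
      have h₄ := key q r p hqr hpr
      have h₅ := key q p r hpq.symm hpr.symm
      have h₆ := key r p q hpr.symm hpq.symm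
      have hp : p ∈ W → p ∉ D := fun h => hAD (hWA p h)
      have hq : q ∈ W → q ∉ D := fun h => hAD (hWA q h)
      have hr : r ∈ W → r ∉ D := fun h => hAD (hWA r h)
      clear hA hD hclosed hWstep hWA key hAD
      grind)
  have haW : a ∈ W := ⟨ha, .refl⟩
  have hgA := hA g (fun p hp q hq h => by
    have := hg p q h
    rw [if_neg fun h => hAD hp h.1, if_neg fun h => hAD hq h.1] at this
    linarith) a ha b hb
  have hgD := hD g (fun p hp q hq h => by
    have := hg p q h
    rw [if_neg fun h => hAD (hWA _ h.2) hq, if_neg fun h => hAD (hWA _ h.2) hp] at this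
    linarith) u hu u' hu'
  have h₁ := hg u a hua
  have h₂ := hg u' b hub
  rw [if_pos ⟨hu, haW⟩] at h₁
  by_contra hcon
  rw [if_neg fun h => hcon h.2.2, if_neg fun h => hAD hb h.1] at h₂
  linarith

/-- Near vertices are joined by a lattice path inside the box of radius `1` around either. -/
lemma Near.exists_path {d : ℕ} {v w : Vert d} (h : Near v w) :
    Relation.ReflTransGen (fun p q => adj p q ∧ Near p v ∧ Near q v) v w := by
  classical
  have key : ∀ S : Finset (Fin d), Relation.ReflTransGen
      (fun p q => adj p q ∧ Near p v ∧ Near q v) v (fun i => if i ∈ S then w i else v i) := by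
    intro S
    have hnear : ∀ S : Finset (Fin d), Near (fun i => if i ∈ S then w i else v i) v := by
      intro S i
      have := h.symm i
      dsimp only
      split_ifs <;> simp [this]
    induction S using Finset.induction_on with
    | empty => simpa using Relation.ReflTransGen.refl
    | insert j S hj ih =>
      by_cases hvw : w j = v j
      · convert ih using 2 with i
        grind
      · refine ih.tail ⟨?_, hnear _, hnear _⟩
        have hj1 := h j
        unfold adj
        rw [Finset.sum_eq_single j]
        · simp only [hj, Finset.mem_insert]
          grind
        · intro i _ hij
          simp [Finset.mem_insert, hij]
        · simp
  simpa using key Finset.univ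

lemma Vset_subset_V1 {d : ℕ} {ω : Config d} {x : Vert d} : Vset ω x ⊆ V1 ω x :=
  fun v hv => ⟨v, hv, Near.refl v⟩

lemma V1_subset_V2 {d : ℕ} {ω : Config d} {x : Vert d} : V1 ω x ⊆ V2 ω x :=
  fun v hv => ⟨v, hv, Near.refl v⟩

/-- A vertex of `V₁(x)` near a vertex outside `V₁(x)` is wired. -/
lemma wired_of_near_notMem_V1 {d : ℕ} {ω : Config d} {x u v : Vert d} (hv : v ∈ V1 ω x)
    (hu : u ∉ V1 ω x) (huv : Near u v) : Wired ω v := by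
  by_contra hw
  obtain ⟨c, hc, hvc⟩ := hv
  refine hu ⟨v, ?_, huv⟩
  by_cases hcv : c = v
  · exact hcv ▸ hc
  · exact ⟨hc.1, hc.2.tail ⟨hw, hcv, Near.symm hvc⟩⟩

lemma V1_connected {d : ℕ} {ω : Config d} {x : Vert d} (g : Vert d → ℤ)
    (hg : ∀ u ∈ V1 ω x, ∀ v ∈ V1 ω x, Near u v → g u = g v) :
    ∀ u ∈ V1 ω x, ∀ v ∈ V1 ω x, g u = g v := by
  have hC : ∀ c ∈ Vset ω x, g c = g x := by
    rintro c ⟨hx, hc⟩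
    induction hc with
    | refl => rfl
    | tail hb hbc ih =>
      rw [← ih]
      exact hg _ (Vset_subset_V1 ⟨hx, hb.tail hbc⟩) _ (Vset_subset_V1 ⟨hx, hb⟩)
        (Near.symm hbc.2.2)
  have h : ∀ u ∈ V1 ω x, g u = g x := by
    rintro u ⟨c, hc, huc⟩
    rw [← hC c hc]
    exact hg u ⟨c, hc, huc⟩ c (Vset_subset_V1 hc) huc
  exact fun u hu v hv => (h u hu).trans (h v hv).symm

/-- A wired vertex of `V₁(x)` is joined to each near vertex by an open path in `V₂(x)`. -/
lemma Wired.exists_path {d : ℕ} {ω : Config d} {x v w : Vert d} (hv : v ∈ V1 ω x)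
    (hw : Wired ω v) (h : Near v w) :
    Relation.ReflTransGen (fun p q => edgeOpen ω p q ∧ q ∈ V2 ω x) v w :=
  Relation.ReflTransGen.mono
    (fun p q hpq => ⟨hw p q hpq.1 hpq.2.1 hpq.2.2, v, hv, hpq.2.2⟩) _ _ h.exists_path

/-- An excursion outside `V₁(x)` can be replaced by an open path in `V₂(x)`. -/
lemma exists_path_of_excursion {d : ℕ} {ω : Config d} {x a b u u' : Vert d} (ha : a ∈ V1 ω x)
    (hb : b ∈ V1 ω x) (hu : u ∉ V1 ω x) (hua : Near u a) (hub : Near u' b)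
    (hpath : Relation.ReflTransGen (fun p q => Near p q ∧ q ∉ V1 ω x) u u') :
    Relation.ReflTransGen (fun p q => edgeOpen ω p q ∧ q ∈ V2 ω x) a b := by
  let D : Set (Vert d) :=
    {y | Relation.ReflTransGen (fun p q => Near p q ∧ q ∉ V1 ω x) u y}
  have hDV : ∀ y ∈ D, y ∉ V1 ω x := by
    intro y hy
    rcases Relation.ReflTransGen.cases_tail hy with rfl | ⟨_, _, h⟩
    exacts [hu, h.2]
  have hDconn : ∀ g : Vert d → ℤ, (∀ p ∈ D, ∀ q ∈ D, Near p q → g p = g q) →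
      ∀ p ∈ D, ∀ q ∈ D, g p = g q := by
    intro g hg
    have h : ∀ y ∈ D, g u = g y := by
      intro y hy
      induction hy with
      | refl => rfl
      | tail hb hbc ih => exact ih.trans (hg _ hb _ (hb.tail hbc) hbc.1)
    exact fun p hp q hq => (h p hp).symm.trans (h q hq)
  have hchain := boundary_connected (V1_connected (ω := ω) (x := x)) hDconn
    (Set.disjoint_right.2 hDV) (fun p hp q hpq hq => Relation.ReflTransGen.tail hp ⟨hpq, hq⟩)
    ha hb .refl hpath hua hub
  have key : ∀ w, Relation.ReflTransGen
      (fun p q => Near p q ∧ q ∈ V1 ω x ∧ ∃ y ∈ D, Near y q) a w →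
      (w ∈ V1 ω x ∧ Wired ω w) ∧
        Relation.ReflTransGen (fun p q => edgeOpen ω p q ∧ q ∈ V2 ω x) a w := by
    intro w hw
    induction hw with
    | refl => exact ⟨⟨ha, wired_of_near_notMem_V1 ha hu hua⟩, .refl⟩
    | tail _ hbc ih =>
      obtain ⟨hnear, hc, y, hy, hyc⟩ := hbc
      exact ⟨⟨hc, wired_of_near_notMem_V1 hc (hDV y hy) hyc⟩,
        ih.2.trans (Wired.exists_path ih.1.1 ih.1.2 hnear)⟩
  exact (key b hchain).2

lemma Conn.reflTransGen {d : ℕ} {ω : Config d} {s t : Vert d} (h : Conn ω s t) :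
    Relation.ReflTransGen (edgeOpen ω) s t := by
  have hne : {n : ℕ∞ | ∃ l : List (Vert d), List.Chain (edgeOpen ω) s l ∧
      (s :: l).getLast (by simp) = t ∧ n = l.length}.Nonempty := by
    by_contra hne
    rw [Set.not_nonempty_iff_eq_empty] at hne
    exact h (by rw [chemDist, hne, sInf_empty])
  obtain ⟨_, l, hl, hlast, _⟩ := hne
  exact List.relationReflTransGen_of_exists_isChain_cons l hl hlast

lemma exists_chain_of_reflTransGen {α : Type*} {r : α → α → Prop} {S : Set α} {s t : α}
    (hs : s ∈ S) (h : Relation.ReflTransGen (fun p q => r p q ∧ q ∈ S) s t) :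
    ∃ l : List α, List.IsChain r (s :: l) ∧
      (s :: l).getLast (by simp) = t ∧ ∀ v ∈ s :: l, v ∈ S := by
  induction h using Relation.ReflTransGen.head_induction_on with
  | refl => exact ⟨[], by simp, rfl, by simpa using hs⟩
  | head hac _ ih =>
    obtain ⟨l, hl, hlast, hmem⟩ := ih hac.2
    exact ⟨_ :: l, List.isChain_cons_cons.2 ⟨hac.1, hl⟩, by simpa using hlast,
      List.forall_mem_cons.2 ⟨hs, hmem⟩⟩

/-- Open connections between vertices of `V₁(x)` can be realised in `V₂(x)`. -/
lemma reflTransGen_within_V2 {d : ℕ} {ω : Config d} {x s t : Vert d} (hs : s ∈ V1 ω x)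
    (ht : t ∈ V1 ω x) (hst : Relation.ReflTransGen (edgeOpen ω) s t) :
    Relation.ReflTransGen (fun p q => edgeOpen ω p q ∧ q ∈ V2 ω x) s t := by
  have key : ∀ y, Relation.ReflTransGen (edgeOpen ω) s y →
      (y ∈ V1 ω x ∧
        Relation.ReflTransGen (fun p q => edgeOpen ω p q ∧ q ∈ V2 ω x) s y) ∨
      (y ∉ V1 ω x ∧ ∃ a ∈ V1 ω x,
        Relation.ReflTransGen (fun p q => edgeOpen ω p q ∧ q ∈ V2 ω x) s a ∧
        ∃ u ∉ V1 ω x, Near u a ∧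
          Relation.ReflTransGen (fun p q => Near p q ∧ q ∉ V1 ω x) u y) := by
    intro y hy
    induction hy with
    | refl => exact .inl ⟨hs, .refl⟩
    | @tail y z _ hyz ih =>
      have hnear : Near y z := hyz.1.near
      by_cases hz : z ∈ V1 ω x
      · refine .inl ⟨hz, ?_⟩
        rcases ih with ⟨_, hsy⟩ | ⟨_, a, ha, hsa, u, hu, hua, huy⟩
        · exact hsy.tail ⟨hyz, V1_subset_V2 hz⟩
        · exact hsa.trans (exists_path_of_excursion ha hz hu hua hnear huy)
      · refine .inr ⟨hz, ?_⟩
        rcases ih with ⟨hy, hsy⟩ | ⟨_, a, ha, hsa, u, hu, hua, huy⟩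
        · exact ⟨y, hy, hsy, z, hz, hnear.symm, .refl⟩
        · exact ⟨a, ha, hsa, u, hu, hua, huy.tail ⟨hnear, hz⟩⟩
  rcases key t hst with h | h
  exacts [h.2, absurd ht h.1]

/-- If `V(x)` is finite and `s, t ∈ V₁(x)` are connected by an open path, then there is
an open path from `s` to `t` all of whose vertices lie in `V₂(x)`. -/
theorem open_path_within_V2 (d : ℕ) (hd : 2 ≤ d) (ω : Config d) (x : Vert d)
    (hfin : (Vset ω x).Finite) (s t : Vert d)
    (hs : s ∈ V1 ω x) (ht : t ∈ V1 ω x) (hst : Conn ω s t) :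
    ∃ l : List (Vert d), List.Chain (edgeOpen ω) s l ∧
      (s :: l).getLast (by simp) = t ∧ ∀ v ∈ s :: l, v ∈ V2 ω x := by
  exact exists_chain_of_reflTransGen (V1_subset_V2 hs)
    (reflTransGen_within_V2 hs ht hst.reflTransGen)

end ChemDist
end

section
/- Fix η > 0 and a positive integer M. For each r̂ ∈ (1/M)ℤ^d ∩ 𝒮₁ (the ℓ¹ unit sphere), let L_{Mr̂} be the linear map given by Lemma 2.1 applied to Mr̂ (so L_{Mr̂}(e_i) = g_i(Mr̂) with g₁ = Id and g_i ∈ 𝒪(ℤ^d), hence L_{Mr̂} maps ℤ^d into ℤ^d). For each positive integer N define the field (R^{N,r̂}_ē)_{ē∈𝔼^d} by: for an edge ē = {x̄,ȳ} of ℤ^d, R^{N,r̂}_ē = 1 on the event { D( I^N_{L_{Mr̂}(x̄)}, I^N_{L_{Mr̂}(ȳ)} ) ≤ NMμ(r̂)(1+η) } and 0 otherwise. Then there exists a function p̄ : ℕ → [0,1], independent of the choice of r̂ ∈ (1/M)ℤ^d ∩ 𝒮₁, such that lim_{N→∞} p̄(N) = 1 and, for every N and every such r̂, the law of (R^{N,r̂}_ē)_{ē∈𝔼^d}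 on {0,1}^{𝔼^d} stochastically dominates Ber(p̄(N))^{⊗𝔼^d}. -/
open MeasureTheory Filter
open scoped ENNReal

namespace ChemDist

/-- `ℓ¹` distance on `ℤ^d`. -/
def dist1 {d : ℕ} (a b : Vert d) : ℤ := ∑ i, |a i - b i|

/-- Lexicographic order on the coordinates of `ℤ^d`. -/
def lexLE {d : ℕ} (a b : Vert d) : Prop :=
  a = b ∨ ∃ i : Fin d, a i < b i ∧ ∀ j, j < i → a j = b j

/-- `a` precedes `b` for the "closest to `c` in `‖·‖₁`, lexicographic tie-breaking"
order. -/
def keyLE {d : ℕ} (c a b : Vert d) : Prop :=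
  dist1 a c < dist1 b c ∨ (dist1 a c = dist1 b c ∧ lexLE a b)

/-- The set `𝓘_x^N = { y : ‖y - Nx‖₁ ≤ √N and y ↔ ∂𝓑₁(Nx, N) }`. -/
def calI {d : ℕ} (ω : Config d) (x : Vert d) (N : ℕ) : Set (Vert d) :=
  {y | ((dist1 y (N • x) : ℤ) : ℝ) ≤ Real.sqrt N ∧
    ∃ z : Vert d, dist1 z (N • x) = (N : ℤ) ∧ Conn ω y z}

/-- `I` is the function `(ω, x, N) ↦ I_x^N`: the point of `𝓘_x^N` closest to `Nx` in
`‖·‖₁` (lexicographic tie-breaking), and `Nx` itself when `𝓘_x^N = ∅`. -/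
def IpointSpec {d : ℕ} (I : Config d → Vert d → ℕ → Vert d) : Prop :=
  ∀ (ω : Config d) (x : Vert d) (N : ℕ),
    (calI ω x N = ∅ → I ω x N = N • x) ∧
    ((calI ω x N).Nonempty →
      I ω x N ∈ calI ω x N ∧ ∀ y ∈ calI ω x N, keyLE (N • x) (I ω x N) y)

/-- `g` belongs to `𝒪(ℤ^d)` (acting on `ℤ^d`): a signed permutation of the
coordinates. -/
def IsSignedPermZ {d : ℕ} (g : Vert d → Vert d) : Prop :=
  ∃ (σ : Equiv.Perm (Fin d)) (ε : Fin d → ℤ),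
    (∀ i, ε i = 1 ∨ ε i = -1) ∧ ∀ (x : Vert d) (i : Fin d), g x i = ε i * x (σ i)

/-- The linear map `L` with `L(eᵢ) = gᵢ(w)`, acting on `ℤ^d`. -/
def Lmap {d : ℕ} (g : Fin d → Vert d → Vert d) (w : Vert d) (z : Vert d) : Vert d :=
  fun j => ∑ i, z i * g i w j

/-- The macroscopic field `R^{N,r̂}`: the macroscopic edge `ē = {x̄, ȳ}` is open when
`D(I^N_{L(x̄)}, I^N_{L(ȳ)}) ≤ thr`. -/
noncomputable def Rfield {d : ℕ} (I : Config d → Vert d → ℕ → Vert d)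
    (g : Fin d → Vert d → Vert d) (w : Vert d) (N : ℕ) (thr : ℝ)
    (ω : Config d) : Config d :=
  fun e => @decide
    (∀ a b : Vert d, e.1 = s(a, b) →
      Conn ω (I ω (Lmap g w a) N) (I ω (Lmap g w b) N) ∧
        chemDistR ω (I ω (Lmap g w a) N) (I ω (Lmap g w b) N) ≤ thr)
    (Classical.propDecidable _)

/-! ### Product Bernoulli measures -/

section ProductMeasure

variable {ι : Type*}

/-- The Bernoulli measure on `Bool`. -/
noncomputable def bern (p : unitInterval) : Measure Bool :=
  ENNReal.ofReal p • Measure.dirac true + ENNReal.ofReal (1 - p) • Measure.dirac false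

lemma bern_singleton (p : unitInterval) (b : Bool) :
    bern p {b} = if b then ENNReal.ofReal p else ENNReal.ofReal (1 - p) := by
  cases b <;> simp [bern]

instance (p : unitInterval) : IsProbabilityMeasure (bern p) := by
  constructor
  have h : (p : ℝ) + (1 - p) = 1 := by ring
  simp [bern, ← ENNReal.ofReal_add p.2.1 (sub_nonneg.2 p.2.2), h]

/-- The product of Bernoulli measures with site-dependent parameter. -/
noncomputable def prodBern (p : ι → unitInterval) : Measure (ι → Bool) :=
  Measure.infinitePi fun i => bern (p i)

instance (p : ι → unitInterval) : IsProbabilityMeasure (prodBern p) := by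
  unfold prodBern; infer_instance

lemma prodBern_cylinder (p : ι → unitInterval) (s : Finset ι) (η : ι → Bool) :
    prodBern p {ω | ∀ e ∈ s, ω e = η e} =
      ∏ e ∈ s, (if η e then ENNReal.ofReal (p e) else ENNReal.ofReal (1 - p e)) := by
  have h : {ω : ι → Bool | ∀ e ∈ s, ω e = η e} = (s : Set ι).pi fun e => {η e} := by
    ext; simp [Set.mem_pi]
  rw [h, prodBern, Measure.infinitePi_pi _ (fun _ _ => measurableSet_singleton _)]
  exact Finset.prod_congr rfl fun i _ => bern_singleton _ _

lemma prodBern_real_cylinder (p : ι → unitInterval) (s : Finset ι) (η : ι → Bool) :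
    (prodBern p).real {ω | ∀ e ∈ s, ω e = η e} =
      ∏ e ∈ s, (if η e then (p e : ℝ) else 1 - p e) := by
  rw [Measure.real, prodBern_cylinder, ENNReal.toReal_prod]
  refine Finset.prod_congr rfl fun e _ => ?_
  split_ifs
  · exact ENNReal.toReal_ofReal (p e).2.1
  · exact ENNReal.toReal_ofReal (sub_nonneg.2 (p e).2.2)

lemma isProductBernoulli_prodBern (p : unitInterval) :
    IsProductBernoulli p (prodBern fun _ : ι => p) :=
  ⟨inferInstance, fun s η => prodBern_cylinder _ s η⟩

lemma exists_preimage_restrict_of_dependsOn {A : Set (ι → Bool)} {F : Finset ι}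
    (hA : DependsOn (fun ω => ω ∈ A) (F : Set ι)) :
    ∃ B : Set (F → Bool), A = (fun ω (i : F) => ω i) ⁻¹' B := by
  refine ⟨(fun ω (i : F) => ω i) '' A, Set.Subset.antisymm (Set.subset_preimage_image _ _) ?_⟩
  rintro ω ⟨ω', h', h⟩
  have := hA (x := ω') (y := ω) fun i hi => congrFun h ⟨i, hi⟩
  exact (iff_of_eq this).1 h'

lemma measurableSet_of_dependsOn {A : Set (ι → Bool)} {F : Finset ι}
    (hA : DependsOn (fun ω => ω ∈ A) (F : Set ι)) : MeasurableSet A := by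
  obtain ⟨B, rfl⟩ := exists_preimage_restrict_of_dependsOn hA
  exact measurableSet_preimage (by fun_prop) B.toFinite.measurableSet

lemma dependsOn_apply_eq (v : ι) (b : Bool) :
    DependsOn (fun x => x ∈ {x : ι → Bool | x v = b}) (({v} : Finset ι) : Set ι) := by
  intro x y hxy
  simp only [Set.mem_ofPred_eq, hxy v (by simp)]

lemma measurableSet_apply_eq (v : ι) (b : Bool) : MeasurableSet {x : ι → Bool | x v = b} :=
  measurableSet_of_dependsOn (dependsOn_apply_eq v b)

lemma dependsOn_cylinder (s : Finset ι) (η : ι → Bool) :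
    DependsOn (fun x => x ∈ {x : ι → Bool | ∀ u ∈ s, x u = η u}) (s : Set ι) := by
  intro x y hxy
  simp only [Set.mem_ofPred_eq, eq_iff_iff]
  exact forall₂_congr fun u hu => by rw [hxy u hu]

lemma measurableSet_cylinder (s : Finset ι) (η : ι → Bool) :
    MeasurableSet {x : ι → Bool | ∀ u ∈ s, x u = η u} :=
  measurableSet_of_dependsOn (dependsOn_cylinder s η)

lemma measure_eq_of_dependsOn {μ ν : Measure (ι → Bool)} {F : Finset ι}
    (h : ∀ η : ι → Bool, μ {ω | ∀ e ∈ F, ω e = η e} = ν {ω | ∀ e ∈ F, ω e = η e})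
    {A : Set (ι → Bool)} (hA : DependsOn (fun ω => ω ∈ A) (F : Set ι)) : μ A = ν A := by
  classical
  have hm : Measurable fun (ω : ι → Bool) (i : F) => ω i := by fun_prop
  have key : μ.map (fun ω (i : F) => ω i) = ν.map (fun ω (i : F) => ω i) := by
    refine Measure.ext_of_singleton fun a => ?_
    rw [Measure.map_apply hm (measurableSet_singleton _),
      Measure.map_apply hm (measurableSet_singleton _)]
    have : (fun (ω : ι → Bool) (i : F) => ω i) ⁻¹' {a} =
        {ω | ∀ e ∈ F, ω e = if h : e ∈ F then a ⟨e, h⟩ else false} := by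
      ext ω
      simp only [Set.mem_preimage, Set.mem_singleton_iff, funext_iff, Subtype.forall,
        Set.mem_ofPred_eq]
      exact forall₂_congr fun i hi => by simp [hi]
    rw [this, h]
  obtain ⟨B, rfl⟩ := exists_preimage_restrict_of_dependsOn hA
  rw [← Measure.map_apply hm B.toFinite.measurableSet,
    ← Measure.map_apply hm B.toFinite.measurableSet, key]

/-- Two finite measures on `ι → Bool` that agree on cylinders over a cofinal family of finite
sets coincide. -/
lemma measure_ext_of_cylinder {μ ν : Measure (ι → Bool)} [IsFiniteMeasure μ]
    (h : ∀ s : Finset ι, ∃ F, s ⊆ F ∧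
      ∀ η : ι → Bool, μ {ω | ∀ e ∈ F, ω e = η e} = ν {ω | ∀ e ∈ F, ω e = η e}) : μ = ν := by
  have key : ∀ s : Finset ι, ∀ B : Set (s → Bool),
      μ ((fun ω (i : s) => ω i) ⁻¹' B) = ν ((fun ω (i : s) => ω i) ⁻¹' B) := by
    intro s B
    obtain ⟨F, hF, hη⟩ := h s
    refine measure_eq_of_dependsOn hη fun x y hxy => ?_
    have : (fun i : s => x i) = fun i : s => y i := funext fun i => hxy i (hF i.2)
    simp [this]
  refine IsProjectiveLimit.unique (P := fun s => μ.map (fun ω (i : s) => ω i))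
    (fun s => rfl) (fun s => ?_)
  refine Measure.ext fun B hB => ?_
  rw [Measure.map_apply (by fun_prop) hB]
  exact (key s B).symm.trans (Measure.map_apply (by fun_prop) hB).symm

lemma IsProductBernoulli.eq_prodBern {p : unitInterval} {P : Measure (ι → Bool)}
    (hP : IsProductBernoulli p P) : P = prodBern fun _ => p := by
  have := hP.1
  refine measure_ext_of_cylinder fun s => ⟨s, subset_rfl, fun η => ?_⟩
  rw [hP.2, prodBern_cylinder]

lemma indepFun_restrict_prodBern (p : ι → unitInterval) {F G : Finset ι} (h : Disjoint F G) :
    ProbabilityTheory.IndepFun (fun (ω : ι → Bool) (i : F) => ω i)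
      (fun (ω : ι → Bool) (i : G) => ω i) (prodBern p) :=
  (ProbabilityTheory.iIndepFun_infinitePi (P := fun i => bern (p i))
    (X := fun _ b => b) (fun _ => measurable_id)).indepFun_finset F G h
    (fun i => measurable_pi_apply i)

lemma measure_inter_of_dependsOn (p : ι → unitInterval) {A B : Set (ι → Bool)} {F G : Finset ι}
    (h : Disjoint F G) (hA : DependsOn (fun ω => ω ∈ A) (F : Set ι))
    (hB : DependsOn (fun ω => ω ∈ B) (G : Set ι)) :
    (prodBern p).real (A ∩ B) = (prodBern p).real A * (prodBern p).real B := by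
  obtain ⟨A, rfl⟩ := exists_preimage_restrict_of_dependsOn hA
  obtain ⟨B, rfl⟩ := exists_preimage_restrict_of_dependsOn hB
  simp only [Measure.real]
  rw [← ENNReal.toReal_mul, (ProbabilityTheory.indepFun_iff_measure_inter_preimage_eq_mul.1
    (indepFun_restrict_prodBern p h)) A B A.toFinite.measurableSet B.toFinite.measurableSet]

lemma map_prodBern_of_injective (p : unitInterval) {f : ι → ι} (hf : Function.Injective f) :
    (prodBern fun _ : ι => p).map (fun ω i => ω (f i)) = prodBern fun _ => p :=
  Measure.map_infinitePi_infinitePi_of_inj (P := fun _ : ι => bern p) hf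

end ProductMeasure

/-! ### Domination of a product measure from conditional lower bounds -/

section Thinning

variable {ι : Type*} [Countable ι]

variable (ι) in
/-- An injective numbering of a countable type. -/
noncomputable def rank : ι → ℕ := (exists_injective_nat ι).choose

lemma rank_injective : Function.Injective (rank ι) := (exists_injective_nat ι).choose_spec

variable (ι) in
/-- The finite set of the elements of rank smaller than `n`. -/
noncomputable def below (n : ℕ) : Finset ι :=
  ((Set.finite_lt_nat n).preimage (rank_injective (ι := ι)).injOn).toFinset

lemma mem_below {n : ℕ} {u : ι} : u ∈ below ι n ↔ rank ι u < n := by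
  simp [below]

lemma exists_subset_below (s : Finset ι) : ∃ n, s ⊆ below ι n := by
  refine ⟨s.sup (rank ι) + 1, fun u hu => mem_below.2 ?_⟩
  exact Nat.lt_succ_of_le (Finset.le_sup (f := rank ι) hu)

/-- The set of the open coordinates of rank smaller than `n`. -/
noncomputable def hist (n : ℕ) (x : ι → Bool) : Finset ι :=
  {u ∈ below ι n | x u = true}

open scoped Classical in
/-- The cylinder of the configurations with history `h` up to rank `n`. -/
def histCyl (n : ℕ) (h : Finset ι) : Set (ι → Bool) :=
  {x | ∀ u ∈ below ι n, x u = decide (u ∈ h)}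

lemma hist_eq_iff {n : ℕ} {x : ι → Bool} {h : Finset ι} (hh : h ⊆ below ι n) :
    hist n x = h ↔ x ∈ histCyl n h := by
  simp only [hist, Finset.ext_iff, Finset.mem_filter, histCyl, Set.mem_ofPred_eq]
  constructor
  · intro H u hu
    have := H u
    by_cases hx : u ∈ h <;> simp_all
  · intro H u
    by_cases hu : u ∈ below ι n
    · simp [hu, H u hu]
    · simp [hu, show u ∉ h from fun h' => hu (hh h')]

lemma hist_of_mem_histCyl {n m : ℕ} (hmn : m ≤ n) {x : ι → Bool} {h : Finset ι}
    (hx : x ∈ histCyl n h) :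
    hist m x = hist m fun u => @decide (u ∈ h) (Classical.propDecidable _) := by
  refine Finset.filter_congr fun u hu => ?_
  rw [hx u (mem_below.2 ((mem_below.1 hu).trans_le hmn))]
  simp

/-- The retention probability: given the history `h`, an open coordinate is kept with this
probability. -/
noncomputable def keepProb (ν : Measure (ι → Bool)) (q : ℝ) (k : ι × Finset ι) : unitInterval :=
  Set.projIcc 0 1 zero_le_one
    (q * ν.real (histCyl (rank ι k.1) k.2) /
      ν.real (histCyl (rank ι k.1) k.2 ∩ {x | x k.1 = true}))

/-- The sequential thinning of `x` by means of the auxiliary bits `y`. -/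
noncomputable def thin (xy : (ι → Bool) × (ι × Finset ι → Bool)) : ι → Bool :=
  fun v => xy.1 v && xy.2 (v, hist (rank ι v) xy.1)

lemma thin_le (xy : (ι → Bool) × (ι × Finset ι → Bool)) : thin xy ≤ xy.1 := by
  intro v
  simp only [thin]
  cases xy.1 v <;> simp

lemma measurableSet_histCyl (n : ℕ) (h : Finset ι) : MeasurableSet (histCyl (ι := ι) n h) :=
  measurableSet_cylinder _ _

lemma measurable_thin : Measurable (thin (ι := ι)) := by
  refine measurable_pi_lambda _ fun v => measurable_to_bool ?_
  have h : (fun xy : (ι → Bool) × (ι × Finset ι → Bool) => thin xy v) ⁻¹' {true} =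
      ⋃ h ∈ (below ι (rank ι v)).powerset,
        (histCyl (rank ι v) h ∩ {x | x v = true}) ×ˢ {y | y (v, h) = true} := by
    ext ⟨x, y⟩
    simp only [Set.mem_preimage, thin, Bool.and_eq_true, Set.mem_singleton_iff, Set.mem_iUnion,
      Set.mem_prod, Set.mem_inter_iff, Set.mem_ofPred_eq, exists_prop, Finset.mem_powerset]
    constructor
    · rintro ⟨h1, h2⟩
      have hs : hist (rank ι v) x ⊆ below ι (rank ι v) := Finset.filter_subset _ _
      exact ⟨_, hs, ⟨(hist_eq_iff hs).1 rfl, h1⟩, h2⟩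
    · rintro ⟨h, hs, ⟨h0, h1⟩, h2⟩
      rw [← hist_eq_iff hs] at h0
      exact ⟨h1, h0 ▸ h2⟩
  rw [h]
  refine Finset.measurableSet_biUnion _ fun h _ => MeasurableSet.prod
    ((measurableSet_histCyl _ _).inter (measurableSet_apply_eq v true))
    (measurableSet_apply_eq (v, h) true)

variable {ν : Measure (ι → Bool)} [IsProbabilityMeasure ν] {q : unitInterval}

lemma mul_keepProb
    (hν : ∀ (S : Finset ι) (v : ι), v ∉ S → ∀ z : ι → Bool,
      ν.real ({x | ∀ u ∈ S, x u = z u} ∩ {x | x v = false}) ≤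
        (1 - q) * ν.real {x | ∀ u ∈ S, x u = z u}) (v : ι) (h : Finset ι) :
    ν.real (histCyl (rank ι v) h ∩ {x | x v = true}) * keepProb ν q (v, h) =
      q * ν.real (histCyl (rank ι v) h) := by
  classical
  have h1 := hν (below ι (rank ι v)) v (by simp [mem_below]) fun u => decide (u ∈ h)
  have h2 : ν.real (histCyl (rank ι v) h ∩ {x | x v = true}) +
      ν.real (histCyl (rank ι v) h ∩ {x | x v = false}) = ν.real (histCyl (rank ι v) h) := by
    rw [← measureReal_inter_add_sdiff (s := histCyl (rank ι v) h) (t := {x | x v = true})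
      (measurableSet_apply_eq v true)]
    congr 2
    ext x; simp
  have h3 : {x : ι → Bool | ∀ u ∈ below ι (rank ι v), x u = decide (u ∈ h)} =
    histCyl (rank ι v) h := by ext; simp [histCyl]
  rw [h3] at h1
  set a := ν.real (histCyl (rank ι v) h ∩ {x | x v = true})
  set b := ν.real (histCyl (rank ι v) h)
  have ha : 0 ≤ a := measureReal_nonneg
  have hb : 0 ≤ b := measureReal_nonneg
  have hab : q * b ≤ a := by linarith
  have hqb : 0 ≤ q * b := mul_nonneg q.2.1 hb
  rcases ha.eq_or_lt with h0 | h0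
  · rw [← h0] at hab ⊢
    linarith
  · rw [keepProb, Set.projIcc_of_mem zero_le_one
      (x := q * ν.real (histCyl (rank ι v) h) / ν.real (histCyl (rank ι v) h ∩ {x | x v = true}))
      ⟨div_nonneg hqb ha, (div_le_one h0).2 hab⟩]
    exact mul_div_cancel₀ _ h0.ne'

lemma thin_inter_eq
    (hν : ∀ (S : Finset ι) (v : ι), v ∉ S → ∀ z : ι → Bool,
      ν.real ({x | ∀ u ∈ S, x u = z u} ∩ {x | x v = false}) ≤
        (1 - q) * ν.real {x | ∀ u ∈ S, x u = z u}) (v : ι) (η : ι → Bool) :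
    (ν.prod (prodBern (keepProb ν q))).real
        ({xy | ∀ u ∈ below ι (rank ι v), thin xy u = η u} ∩ {xy | thin xy v = true}) =
      q * (ν.prod (prodBern (keepProb ν q))).real
        {xy | ∀ u ∈ below ι (rank ι v), thin xy u = η u} := by
  classical
  set n := rank ι v with hn
  set ρ := ν.prod (prodBern (keepProb ν q))
  set E : Set ((ι → Bool) × (ι × Finset ι → Bool)) := {xy | ∀ u ∈ below ι n, thin xy u = η u}
  set T : Set ((ι → Bool) × (ι × Finset ι → Bool)) := {xy | thin xy v = true}
  have hm : ∀ h ∈ (below ι n).powerset, MeasurableSet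
      ((fun xy : (ι → Bool) × (ι × Finset ι → Bool) => hist n xy.1) ⁻¹' {h}) := by
    intro h hh
    have : (fun xy : (ι → Bool) × (ι × Finset ι → Bool) => hist n xy.1) ⁻¹' {h} =
        Prod.fst ⁻¹' histCyl n h := by
      ext xy; exact hist_eq_iff (Finset.mem_powerset.1 hh)
    rw [this]
    exact measurable_fst (measurableSet_histCyl n h)
  have split : ∀ A : Set ((ι → Bool) × (ι × Finset ι → Bool)), MeasurableSet A → ρ.real A =
      ∑ h ∈ (below ι n).powerset, ρ.real (A ∩ {xy | xy.1 ∈ histCyl n h}) := by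
    intro A hA
    have h1 := sum_measureReal_preimage_singleton (μ := ρ.restrict A) (below ι n).powerset hm
    have h2 : (fun xy : (ι → Bool) × (ι × Finset ι → Bool) => hist n xy.1) ⁻¹'
        ((below ι n).powerset : Set (Finset ι)) = Set.univ := by
      ext xy
      exact iff_of_true
        (Finset.mem_coe.2 (Finset.mem_powerset.2 (Finset.filter_subset _ _))) trivial
    rw [h2, measureReal_restrict_apply MeasurableSet.univ, Set.univ_inter] at h1
    rw [← h1]
    refine Finset.sum_congr rfl fun h hh => ?_
    rw [measureReal_restrict_apply (hm h hh), Set.inter_comm]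
    congr 2
    ext xy; exact hist_eq_iff (Finset.mem_powerset.1 hh)
  have hE : MeasurableSet E := by
    have : E = thin ⁻¹' {x | ∀ u ∈ below ι n, x u = η u} := rfl
    rw [this]
    exact measurable_thin (measurableSet_cylinder _ _)
  have hT : MeasurableSet T :=
    (measurable_pi_apply v).comp measurable_thin (measurableSet_singleton true)
  rw [split _ (hE.inter hT), split _ hE, Finset.mul_sum]
  refine Finset.sum_congr rfl fun h hh => ?_
  have hh := Finset.mem_powerset.1 hh
  set key : ι → ι × Finset ι := fun u => (u, hist (rank ι u) fun u => decide (u ∈ h))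
  set B : Set (ι × Finset ι → Bool) :=
    {y | ∀ u ∈ below ι n, (decide (u ∈ h) && y (key u)) = η u}
  set G : Set (ι × Finset ι → Bool) := {y | y (v, h) = true}
  have e1 : E ∩ {xy | xy.1 ∈ histCyl n h} = histCyl n h ×ˢ B := by
    ext ⟨x, y⟩
    simp only [Set.mem_inter_iff, Set.mem_ofPred_eq, Set.mem_prod, E, B, thin]
    rw [and_comm]
    refine and_congr_right fun hx => forall₂_congr fun u hu => ?_
    rw [hist_of_mem_histCyl (mem_below.1 hu).le hx, hx u hu]
    exact Iff.of_eq (by congr!)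
  have e2 : E ∩ T ∩ {xy | xy.1 ∈ histCyl n h} =
      (histCyl n h ∩ {x | x v = true}) ×ˢ (B ∩ G) := by
    rw [Set.inter_right_comm, e1]
    ext ⟨x, y⟩
    simp only [Set.mem_inter_iff, Set.mem_prod, Set.mem_ofPred_eq, T, G, thin, Bool.and_eq_true]
    constructor
    · rintro ⟨⟨hx, hB⟩, h1, h2⟩
      rw [(hist_eq_iff hh).2 hx] at h2
      exact ⟨⟨hx, h1⟩, hB, h2⟩
    · rintro ⟨⟨hx, h1⟩, hB, h2⟩
      rw [(hist_eq_iff hh).2 hx]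
      exact ⟨⟨hx, hB⟩, h1, h2⟩
  have hBG : (prodBern (keepProb ν q)).real (B ∩ G) =
      (prodBern (keepProb ν q)).real B * keepProb ν q (v, h) := by
    have hG : (prodBern (keepProb ν q)).real G = keepProb ν q (v, h) := by
      have := prodBern_real_cylinder (keepProb ν q) {(v, h)} fun _ => true
      simpa using this
    rw [← hG]
    refine measure_inter_of_dependsOn _ (F := (below ι n).image key) (G := {(v, h)}) ?_ ?_ ?_
    · rw [Finset.disjoint_singleton_right, Finset.mem_image]
      rintro ⟨u, hu, huv⟩
      have : u = v := congrArg Prod.fst huv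
      rw [this, mem_below] at hu
      exact lt_irrefl _ hu
    · intro x y hxy
      simp only [B, Set.mem_ofPred_eq, eq_iff_iff]
      exact forall₂_congr fun u hu => by
        rw [hxy (key u) (Finset.mem_coe.2 (Finset.mem_image_of_mem _ hu))]
    · intro x y hxy
      simp only [G, Set.mem_ofPred_eq, hxy (v, h) (by simp)]
  rw [e1, e2]
  simp only [ρ, measureReal_prod_prod]
  rw [hBG, ← mul_assoc, ← mul_assoc, ← mul_keepProb hν v h]
  ring

/-- If, conditionally on the state of any finite set of other coordinates, every coordinate is
closed with probability at most `1 - q`, then thinning produces a product measure. -/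
theorem map_thin_eq_prodBern
    (hν : ∀ (S : Finset ι) (v : ι), v ∉ S → ∀ z : ι → Bool,
      ν.real ({x | ∀ u ∈ S, x u = z u} ∩ {x | x v = false}) ≤
        (1 - q) * ν.real {x | ∀ u ∈ S, x u = z u}) :
    (ν.prod (prodBern (keepProb ν q))).map thin = prodBern fun _ => q := by
  classical
  set ρ := ν.prod (prodBern (keepProb ν q)) with hρ
  have key : ∀ n (η : ι → Bool), ρ.real {xy | ∀ u ∈ below ι n, thin xy u = η u} =
      ∏ u ∈ below ι n, (if η u then (q : ℝ) else 1 - q) := by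
    intro n
    induction n with
    | zero =>
      intro η
      have : below ι 0 = ∅ := by ext; simp [mem_below]
      simp [this]
    | succ n ih =>
      intro η
      by_cases hn : ∃ v, rank ι v = n
      · obtain ⟨v, rfl⟩ := hn
        have hb : below ι (rank ι v + 1) = insert v (below ι (rank ι v)) := by
          ext u
          simp only [mem_below, Finset.mem_insert, Nat.lt_succ_iff_lt_or_eq,
            rank_injective.eq_iff]
          exact or_comm
        have h1 := thin_inter_eq hν v η
        rw [hb, Finset.prod_insert (by simp [mem_below]), ← ih η]
        have h2 := measureReal_inter_add_sdiff (μ := ρ)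
          (s := {xy | ∀ u ∈ below ι (rank ι v), thin xy u = η u})
          (t := {xy | thin xy v = true})
          ((measurable_pi_apply v).comp measurable_thin (measurableSet_singleton true))
        rw [← hρ] at h1
        cases hv : η v
        · have : {xy | ∀ u ∈ insert v (below ι (rank ι v)), thin xy u = η u} =
              {xy | ∀ u ∈ below ι (rank ι v), thin xy u = η u} \ {xy | thin xy v = true} := by
            ext xy; simp [hv, and_comm]
          rw [this]
          simp only [Bool.false_eq_true, if_false]
          linarith
        · have : {xy | ∀ u ∈ insert v (below ι (rank ι v)), thin xy u = η u} =
              {xy | ∀ u ∈ below ι (rank ι v), thin xy u = η u} ∩ {xy | thin xy v = true} := by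
            ext xy; simp [hv, and_comm]
          rw [this]
          simp only [if_true]
          linarith
      · have hb : below ι (n + 1) = below ι n := by
          ext u
          simp only [mem_below, Nat.lt_succ_iff_lt_or_eq]
          exact or_iff_left fun h => hn ⟨u, h⟩
        rw [hb, ih]
  have : IsProbabilityMeasure (ρ.map thin) :=
    Measure.isProbabilityMeasure_map measurable_thin.aemeasurable
  refine measure_ext_of_cylinder fun s => ?_
  obtain ⟨n, hn⟩ := exists_subset_below s
  refine ⟨below ι n, hn, fun η => ?_⟩
  have h1 := key n η
  rw [← prodBern_real_cylinder (fun _ : ι => q)] at h1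
  rw [Measure.map_apply measurable_thin (measurableSet_cylinder _ _)]
  exact (ENNReal.toReal_eq_toReal_iff' (measure_ne_top _ _) (measure_ne_top _ _)).1 h1

theorem integral_prodBern_le_of_cond
    (hν : ∀ (S : Finset ι) (v : ι), v ∉ S → ∀ z : ι → Bool,
      ν.real ({x | ∀ u ∈ S, x u = z u} ∩ {x | x v = false}) ≤
        (1 - q) * ν.real {x | ∀ u ∈ S, x u = z u})
    {f : (ι → Bool) → ℝ} (hf : Measurable f) (hmono : Monotone f) {C : ℝ}
    (hC : ∀ x, |f x| ≤ C) :
    ∫ x, f x ∂(prodBern fun _ => q) ≤ ∫ x, f x ∂ν := by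
  rw [← map_thin_eq_prodBern hν,
    integral_map measurable_thin.aemeasurable hf.aestronglyMeasurable]
  have h : ∫ x, f x ∂ν = ∫ xy, f xy.1 ∂(ν.prod (prodBern (keepProb ν q))) := by
    rw [integral_fun_fst (μ := ν) (ν := prodBern (keepProb ν q)) f]
    simp
  rw [h]
  refine integral_mono ?_ ?_ fun xy => hmono (thin_le xy)
  · exact Integrable.of_bound (hf.comp measurable_thin).aestronglyMeasurable C
      (Eventually.of_forall fun x => hC _)
  · exact Integrable.of_bound (hf.comp measurable_fst).aestronglyMeasurable C
      (Eventually.of_forall fun x => hC _)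

end Thinning

/-! ### Domination for fields with finite-range dependence -/

section FiniteRange

variable {ι : Type*}

/-- The probability that `a && y = b` when `y` is a Bernoulli variable of parameter `r`. -/
def thinWeight (r : ℝ) (a b : Bool) : ℝ :=
  if b then (if a then r else 0) else (if a then 1 - r else 1)

lemma bern_real_and_eq (r : unitInterval) (a b : Bool) :
    (bern r).real {y | (a && y) = b} = thinWeight r a b := by
  have h0 : 0 ≤ 1 - (r : ℝ) := sub_nonneg.2 r.2.2
  have h1 := r.2.1
  rcases a <;> rcases b <;> simp [thinWeight, Measure.real, bern, h0, h1]
  rw [← ENNReal.ofReal_add h1 h0]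
  simp

lemma thinWeight_nonneg (r : unitInterval) (a b : Bool) : 0 ≤ thinWeight r a b := by
  rw [← bern_real_and_eq]; exact measureReal_nonneg

lemma thinWeight_le_one (r : unitInterval) (a b : Bool) : thinWeight r a b ≤ 1 := by
  rw [← bern_real_and_eq]; exact measureReal_le_one

/-- The conditional probability, given `R ω`, that `R ω && y` agrees with `z` on `S`. -/
noncomputable def thinProd {Ω : Type*} (R : Ω → ι → Bool) (r : ℝ) (z : ι → Bool) (S : Finset ι)
    (ω : Ω) : ℝ :=
  ∏ u ∈ S, thinWeight r (R ω u) (z u)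

lemma thinProd_nonneg {Ω : Type*} {R : Ω → ι → Bool} {r : unitInterval} (z : ι → Bool)
    (S : Finset ι) (ω : Ω) : 0 ≤ thinProd R r z S ω :=
  Finset.prod_nonneg fun _ _ => thinWeight_nonneg _ _ _

lemma thinProd_le_one {Ω : Type*} {R : Ω → ι → Bool} {r : unitInterval} (z : ι → Bool)
    (S : Finset ι) (ω : Ω) : thinProd R r z S ω ≤ 1 :=
  Finset.prod_le_one (fun _ _ => thinWeight_nonneg _ _ _) fun _ _ => thinWeight_le_one _ _ _

variable {Ω : Type*} [MeasurableSpace Ω] {P : Measure Ω} {R : Ω → ι → Bool}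
  {r : unitInterval}

lemma measurable_thinWeight (hR : Measurable R) (v : ι) (b : Bool) :
    Measurable fun ω => thinWeight r (R ω v) b :=
  (measurable_of_finite fun a => thinWeight r a b).comp ((measurable_pi_apply v).comp hR)

lemma measurable_thinProd (hR : Measurable R) (z : ι → Bool) (S : Finset ι) :
    Measurable (thinProd R r z S) :=
  Finset.measurable_fun_prod _ fun u _ => measurable_thinWeight hR u (z u)

/-- The law of the coordinatewise minimum of `R` and of independent Bernoulli variables. -/
noncomputable def thinLaw (P : Measure Ω) (R : Ω → ι → Bool) (r : unitInterval) :
    Measure (ι → Bool) :=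
  (P.prod (prodBern fun _ => r)).map fun p v => R p.1 v && p.2 v

lemma measurable_and [Countable ι] (hR : Measurable R) :
    Measurable fun (p : Ω × (ι → Bool)) (v : ι) => R p.1 v && p.2 v := by
  refine measurable_pi_lambda _ fun v => ?_
  have : Measurable fun b : Bool × Bool => b.1 && b.2 := measurable_of_finite _
  exact this.comp ((((measurable_pi_apply v).comp hR).comp measurable_fst).prodMk
    ((measurable_pi_apply v).comp measurable_snd))

lemma thinLaw_real_cylinder [Countable ι] (hR : Measurable R) (z : ι → Bool) (S : Finset ι) :
    (thinLaw P R r).real {x | ∀ u ∈ S, x u = z u} = ∫ ω, thinProd R r z S ω ∂P := by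
  have hm := measurableSet_cylinder S z
  rw [thinLaw, Measure.real, Measure.map_apply (measurable_and hR) hm,
    Measure.prod_apply (measurable_and hR hm), ← integral_toReal]
  · refine integral_congr_ae (Eventually.of_forall fun ω => ?_)
    have : Prod.mk ω ⁻¹' ((fun (p : Ω × (ι → Bool)) (v : ι) => R p.1 v && p.2 v) ⁻¹'
        {x | ∀ u ∈ S, x u = z u}) = (S : Set ι).pi fun u => {y | (R ω u && y) = z u} := by
      ext y; simp [Set.mem_pi]
    simp only [this, prodBern]
    rw [Measure.infinitePi_pi _ fun u _ => Set.Finite.measurableSet (Set.toFinite _),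
      ENNReal.toReal_prod]
    exact Finset.prod_congr rfl fun u _ => bern_real_and_eq r (R ω u) (z u)
  · exact (measurable_measure_prodMk_left (measurable_and hR hm)).aemeasurable
  · exact Eventually.of_forall fun ω => measure_lt_top _ _

variable [IsProbabilityMeasure P]

lemma integrable_thinProd (hR : Measurable R) (z : ι → Bool) (S : Finset ι) :
    Integrable (thinProd R r z S) P :=
  Integrable.of_bound (measurable_thinProd hR z S).aestronglyMeasurable 1
    (Eventually.of_forall fun ω => by
      rw [Real.norm_of_nonneg (thinProd_nonneg z S ω)]; exact thinProd_le_one z S ω)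

lemma measurable_closed (hR : Measurable R) (v : ι) :
    Measurable fun ω => if R ω v then (0 : ℝ) else 1 :=
  (measurable_of_finite fun a : Bool => if a then (0 : ℝ) else 1).comp
    ((measurable_pi_apply v).comp hR)

lemma integrable_closed_mul_thinProd (hR : Measurable R) (z : ι → Bool) (S : Finset ι) (v : ι) :
    Integrable (fun ω => (if R ω v then (0 : ℝ) else 1) * thinProd R r z S ω) P :=
  Integrable.of_bound
    ((measurable_closed hR v).mul (measurable_thinProd hR z S)).aestronglyMeasurable 1
    (Eventually.of_forall fun ω => by
      have h1 := thinProd_nonneg (R := R) (r := r) z S ω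
      have h2 := thinProd_le_one (R := R) (r := r) z S ω
      rw [Real.norm_eq_abs]
      split_ifs <;> simp [abs_of_nonneg h1, h2])

lemma integral_closed_mul_thinProd_le [DecidableEq ι] (hR : Measurable R) {nbr : ι → Finset ι}
    {Δ : ℕ} (hcard : ∀ v, (nbr v).card ≤ Δ)
    (hindep : ∀ v S, Disjoint S (nbr v) →
      ProbabilityTheory.IndepFun (fun ω => R ω v) (fun ω (u : S) => R ω u) P)
    {δ : ℝ} (hδ : ∀ v, P.real {ω | R ω v = false} ≤ δ) {α : ℝ} (hα0 : 0 ≤ α) (hα1 : α ≤ 1)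
    (hδα : δ ≤ (1 - α) * (α * (1 - r)) ^ Δ) (z : ι → Bool) (S : Finset ι) :
    ∀ v ∉ S, ∫ ω, (if R ω v then (0 : ℝ) else 1) * thinProd R r z S ω ∂P ≤
      (1 - α) * ∫ ω, thinProd R r z S ω ∂P := by
  induction S using Finset.strongInduction with
  | H S ih =>
  intro v hv
  have hr0 := r.2.1
  have hr1 : 0 ≤ 1 - (r : ℝ) := sub_nonneg.2 r.2.2
  have hα1' : 0 ≤ 1 - α := sub_nonneg.2 hα1
  set N := S.filter (· ∈ nbr v)
  set M := S.filter (· ∉ nbr v)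
  have hS : S = M ∪ N := by
    rw [Finset.union_comm]
    exact (Finset.filter_union_filter_not_eq _ _).symm
  have hMN : Disjoint M N := (Finset.disjoint_filter_filter_not _ _ _).symm
  set lo : ι → ℝ := fun u => if z u then α * r else 1 - r
  set hi : ι → ℝ := fun u => if z u then (r : ℝ) else 1
  have hlo0 : ∀ u, 0 ≤ lo u := fun u => by simp only [lo]; split_ifs <;> positivity
  have hhi0 : ∀ u, 0 ≤ hi u := fun u => by simp only [hi]; split_ifs <;> positivity
  have hwhi : ∀ a u, thinWeight r a (z u) ≤ hi u := fun a u => by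
    cases a <;> cases hz : z u <;> simp [thinWeight, hi, hz, hr0]
  have hinsert : ∀ T : Finset ι, T ⊂ S → ∀ u ∉ T, lo u * ∫ ω, thinProd R r z T ω ∂P ≤
      ∫ ω, thinProd R r z (insert u T) ω ∂P := by
    intro T hT u hu
    have h1 := ih T hT u hu
    cases hz : z u
    · rw [← integral_const_mul]
      refine integral_mono ((integrable_thinProd hR z T).const_mul _)
        (integrable_thinProd hR z _) fun ω => ?_
      simp only [thinProd, Finset.prod_insert hu]
      refine mul_le_mul_of_nonneg_right ?_ (thinProd_nonneg (R := R) z T ω)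
      simp only [lo, hz, thinWeight]
      cases R ω u <;> simp [hr0]
    · have : ∀ ω, thinProd R r z (insert u T) ω =
          r * (thinProd R r z T ω - (if R ω u then (0 : ℝ) else 1) * thinProd R r z T ω) := by
        intro ω
        simp only [thinProd, Finset.prod_insert hu, hz, thinWeight]
        cases R ω u <;> simp
      simp_rw [this]
      rw [integral_const_mul, integral_sub (integrable_thinProd hR z T)
        (integrable_closed_mul_thinProd hR z T u)]
      simp only [lo, hz, if_true]
      nlinarith
  have hlow : ∀ T ⊆ N, (∏ u ∈ T, lo u) * ∫ ω, thinProd R r z M ω ∂P ≤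
      ∫ ω, thinProd R r z (M ∪ T) ω ∂P := by
    intro T
    induction T using Finset.induction_on with
    | empty => simp
    | insert u T hu ihT =>
      intro hT
      have huN : u ∈ N := hT (Finset.mem_insert_self u T)
      have hTN : T ⊆ N := (Finset.subset_insert u T).trans hT
      have huM : u ∉ M := fun h => Finset.disjoint_left.1 hMN h huN
      have huMT : u ∉ M ∪ T := by simp [huM, hu]
      have hss : M ∪ T ⊂ S := by
        rw [hS]
        refine (Finset.ssubset_iff_of_subset (Finset.union_subset_union_right hTN)).2
          ⟨u, Finset.mem_union_right _ huN, huMT⟩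
      have h1 := hinsert _ hss u huMT
      rw [Finset.union_insert, Finset.prod_insert hu, mul_assoc]
      exact (mul_le_mul_of_nonneg_left (ihT hTN) (hlo0 u)).trans h1
  have hM0 : 0 ≤ ∫ ω, thinProd R r z M ω ∂P := integral_nonneg fun ω => thinProd_nonneg z M ω
  have hup : ∫ ω, (if R ω v then (0 : ℝ) else 1) * thinProd R r z S ω ∂P ≤
      (∏ u ∈ N, hi u) * (δ * ∫ ω, thinProd R r z M ω ∂P) := by
    have hind : ∫ ω, (if R ω v then (0 : ℝ) else 1) * thinProd R r z M ω ∂P =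
        (∫ ω, (if R ω v then (0 : ℝ) else 1) ∂P) * ∫ ω, thinProd R r z M ω ∂P := by
      have h1 := (hindep v M (Finset.disjoint_left.2 fun u hu => (Finset.mem_filter.1 hu).2)).comp
        (φ := fun a : Bool => if a then (0 : ℝ) else 1)
        (ψ := fun x : M → Bool => ∏ u, thinWeight r (x u) (z u))
        (measurable_of_finite _) (measurable_of_finite _)
      have h2 : (fun x : M → Bool => ∏ u, thinWeight r (x u) (z u)) ∘
          (fun ω (u : M) => R ω u) = thinProd R r z M := by
        ext ω
        simp only [Function.comp, thinProd]
        exact Finset.prod_coe_sort M fun u => thinWeight r (R ω u) (z u)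
      rw [h2] at h1
      exact h1.integral_fun_mul_eq_mul_integral (measurable_closed hR v).aestronglyMeasurable
        (measurable_thinProd hR z M).aestronglyMeasurable
    have hcl : ∫ ω, (if R ω v then (0 : ℝ) else 1) ∂P ≤ δ := by
      refine le_trans (le_of_eq ?_) (hδ v)
      have hms : MeasurableSet {ω | R ω v = false} :=
        ((measurable_pi_apply v).comp hR) (measurableSet_singleton false)
      rw [← integral_indicator_one hms]
      refine integral_congr_ae (Eventually.of_forall fun ω => ?_)
      cases h : R ω v <;> simp [Set.indicator, h]
    refine le_trans ?_ (mul_le_mul_of_nonneg_left (mul_le_mul_of_nonneg_right hcl hM0)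
      (Finset.prod_nonneg fun u _ => hhi0 u))
    rw [← hind, ← integral_const_mul]
    refine integral_mono (integrable_closed_mul_thinProd hR z S v)
      ((integrable_closed_mul_thinProd hR z M v).const_mul _) fun ω => ?_
    have h1 : thinProd R r z S ω ≤ (∏ u ∈ N, hi u) * thinProd R r z M ω := by
      rw [hS, thinProd, Finset.prod_union hMN, mul_comm]
      exact mul_le_mul_of_nonneg_right (Finset.prod_le_prod (fun _ _ => thinWeight_nonneg _ _ _)
        fun u _ => hwhi _ u) (thinProd_nonneg z M ω)
    simp only
    split_ifs
    · simp
    · simpa using h1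
  have hlow' := hlow N subset_rfl
  rw [← hS] at hlow'
  refine hup.trans (le_trans ?_ (mul_le_mul_of_nonneg_left hlow' hα1'))
  have hprod : (α * (1 - r)) ^ Δ * ∏ u ∈ N, hi u ≤ ∏ u ∈ N, lo u := by
    have hc0 : 0 ≤ α * (1 - (r : ℝ)) := mul_nonneg hα0 hr1
    have hc1 : α * (1 - (r : ℝ)) ≤ 1 := mul_le_one₀ hα1 hr1 (by linarith)
    have hN : N.card ≤ Δ := (Finset.card_le_card fun u hu => (Finset.mem_filter.1 hu).2).trans
      (hcard v)
    calc (α * (1 - r)) ^ Δ * ∏ u ∈ N, hi u ≤ (α * (1 - r)) ^ N.card * ∏ u ∈ N, hi u :=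
          mul_le_mul_of_nonneg_right (pow_le_pow_of_le_one hc0 hc1 hN)
            (Finset.prod_nonneg fun u _ => hhi0 u)
      _ = ∏ u ∈ N, (α * (1 - r)) * hi u := by
          rw [Finset.prod_mul_distrib, Finset.prod_const]
      _ ≤ ∏ u ∈ N, lo u := by
          refine Finset.prod_le_prod (fun u _ => mul_nonneg hc0 (hhi0 u)) fun u _ => ?_
          have : 0 ≤ α * r := mul_nonneg hα0 hr0
          simp only [hi, lo]
          split_ifs <;> nlinarith
  have hhiN : 0 ≤ ∏ u ∈ N, hi u := Finset.prod_nonneg fun u _ => hhi0 u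
  calc (∏ u ∈ N, hi u) * (δ * ∫ ω, thinProd R r z M ω ∂P)
      = δ * ((∏ u ∈ N, hi u) * ∫ ω, thinProd R r z M ω ∂P) := by ring
    _ ≤ ((1 - α) * (α * (1 - r)) ^ Δ) * ((∏ u ∈ N, hi u) * ∫ ω, thinProd R r z M ω ∂P) :=
        mul_le_mul_of_nonneg_right hδα (mul_nonneg hhiN hM0)
    _ = (1 - α) * (((α * (1 - r)) ^ Δ * ∏ u ∈ N, hi u) * ∫ ω, thinProd R r z M ω ∂P) := by ring
    _ ≤ _ := mul_le_mul_of_nonneg_left (mul_le_mul_of_nonneg_right hprod hM0) hα1'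

/-- A random field with finite-range dependence whose coordinates are closed with a small
probability dominates a product measure of large parameter. -/
theorem integral_prodBern_le_of_finiteRange [Countable ι] (hR : Measurable R)
    {nbr : ι → Finset ι} {Δ : ℕ} (hcard : ∀ v, (nbr v).card ≤ Δ)
    (hindep : ∀ v S, Disjoint S (nbr v) →
      ProbabilityTheory.IndepFun (fun ω => R ω v) (fun ω (u : S) => R ω u) P)
    {δ : ℝ} (hδ : ∀ v, P.real {ω | R ω v = false} ≤ δ)
    (hδr : δ ≤ (1 - r) * (r * (1 - r)) ^ Δ)
    {f : (ι → Bool) → ℝ} (hf : Measurable f) (hmono : Monotone f) {C : ℝ}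
    (hC : ∀ x, |f x| ≤ C) :
    ∫ x, f x ∂(prodBern fun _ => r * r) ≤ ∫ ω, f (R ω) ∂P := by
  classical
  have hr0 := r.2.1
  have hr1 := r.2.2
  have hpr : IsProbabilityMeasure (thinLaw P R r) :=
    Measure.isProbabilityMeasure_map (measurable_and hR).aemeasurable
  have hcond : ∀ (S : Finset ι) (v : ι), v ∉ S → ∀ z : ι → Bool,
      (thinLaw P R r).real ({x | ∀ u ∈ S, x u = z u} ∩ {x | x v = false}) ≤
        (1 - (r * r : unitInterval)) * (thinLaw P R r).real {x | ∀ u ∈ S, x u = z u} := by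
    intro S v hv z
    have h1 := integral_closed_mul_thinProd_le hR hcard hindep hδ hr0 hr1 hδr z S v hv
    set z' : ι → Bool := Function.update z v false
    have hz' : ∀ u ∈ S, z' u = z u := fun u hu =>
      Function.update_of_ne (ne_of_mem_of_not_mem hu hv) _ _
    have h2 : {x : ι → Bool | ∀ u ∈ S, x u = z u} ∩ {x | x v = false} =
        {x | ∀ u ∈ insert v S, x u = z' u} := by
      ext x
      simp only [Set.mem_inter_iff, Set.mem_ofPred_eq, Finset.forall_mem_insert, z',
        Function.update_self]
      rw [and_comm]
      exact and_congr_right fun _ => forall₂_congr fun u hu => by rw [← hz' u hu]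
    rw [h2, thinLaw_real_cylinder hR, thinLaw_real_cylinder hR]
    have h3 : ∀ ω, thinProd R r z' (insert v S) ω = (1 - r) * thinProd R r z S ω +
        r * ((if R ω v then (0 : ℝ) else 1) * thinProd R r z S ω) := by
      intro ω
      have : thinProd R r z' S ω = thinProd R r z S ω :=
        Finset.prod_congr rfl fun u hu => by rw [hz' u hu]
      rw [thinProd, Finset.prod_insert hv]
      change _ * thinProd R r z' S ω = _
      rw [this]
      simp only [z', Function.update_self, thinWeight]
      cases R ω v
      · simp only [Bool.false_eq_true, if_false]
        ring
      · simp
    simp_rw [h3]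
    rw [integral_add ((integrable_thinProd hR z S).const_mul _)
      ((integrable_closed_mul_thinProd hR z S v).const_mul _), integral_const_mul,
      integral_const_mul]
    have h4 := mul_le_mul_of_nonneg_left h1 hr0
    rw [Set.Icc.coe_mul]
    linarith
  refine (integral_prodBern_le_of_cond hcond hf hmono hC).trans ?_
  rw [thinLaw, integral_map (measurable_and hR).aemeasurable hf.aestronglyMeasurable]
  have h : ∫ ω, f (R ω) ∂P =
      ∫ p, f (R p.1) ∂(P.prod (prodBern fun _ : ι => r)) := by
    rw [integral_fun_fst (μ := P) (ν := prodBern fun _ : ι => r) fun ω => f (R ω)]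
    simp
  rw [h]
  refine integral_mono ?_ ?_ fun p => hmono fun v => ?_
  · exact Integrable.of_bound (hf.comp (measurable_and hR)).aestronglyMeasurable C
      (Eventually.of_forall fun x => hC _)
  · exact Integrable.of_bound (hf.comp (hR.comp measurable_fst)).aestronglyMeasurable C
      (Eventually.of_forall fun x => hC _)
  · simp only
    cases R p.1 v <;> simp

end FiniteRange

/-! ### The lattice and its open subgraph -/

section Lattice

variable {d : ℕ}

lemma dist1_nonneg (a b : Vert d) : 0 ≤ dist1 a b := Finset.sum_nonneg fun _ _ => abs_nonneg _

lemma dist1_self (a : Vert d) : dist1 a a = 0 := by simp [dist1]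

lemma dist1_comm (a b : Vert d) : dist1 a b = dist1 b a :=
  Finset.sum_congr rfl fun _ _ => abs_sub_comm _ _

lemma dist1_triangle (a b c : Vert d) : dist1 a c ≤ dist1 a b + dist1 b c := by
  unfold dist1
  rw [← Finset.sum_add_distrib]
  exact Finset.sum_le_sum fun i _ => abs_sub_le _ _ _

lemma abs_sub_le_dist1 (a b : Vert d) (i : Fin d) : |a i - b i| ≤ dist1 a b :=
  Finset.single_le_sum (f := fun i => |a i - b i|) (fun _ _ => abs_nonneg _) (Finset.mem_univ i)

lemma dist1_add_right (a b t : Vert d) : dist1 (a + t) (b + t) = dist1 a b := by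
  simp [dist1]

lemma dist1_eq_zero {a b : Vert d} : dist1 a b = 0 ↔ a = b := by
  refine ⟨fun h => funext fun i => ?_, fun h => h ▸ dist1_self a⟩
  have := abs_sub_le_dist1 a b i
  have := abs_nonneg (a i - b i)
  exact sub_eq_zero.1 (abs_eq_zero.1 (by omega))

lemma finite_dist1_le (c : Vert d) (n : ℤ) : {x : Vert d | dist1 x c ≤ n}.Finite := by
  refine (Set.finite_Icc (fun i => c i - n) (fun i => c i + n)).subset fun x hx => ?_
  have h : ∀ i, |x i - c i| ≤ n := fun i => (abs_sub_le_dist1 x c i).trans hx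
  exact ⟨fun i => by have := abs_le.1 (h i); simp only; omega,
    fun i => by have := abs_le.1 (h i); simp only; omega⟩

/-- The graph of open edges. -/
def openGraph (ω : Config d) : SimpleGraph (Vert d) where
  Adj := edgeOpen ω
  symm := ⟨by
    rintro x y ⟨h, ho⟩
    refine ⟨(dist1_comm y x).trans h, ?_⟩
    rw [← ho]
    congr 2
    exact Sym2.eq_swap⟩
  loopless := ⟨fun x ⟨h, _⟩ => by
    have : dist1 x x = 1 := h
    rw [dist1_self] at this
    exact absurd this (by norm_num)⟩

lemma exists_walk_of_isChain {ω : Config d} (l : List (Vert d)) :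
    ∀ x, List.IsChain (edgeOpen ω) (x :: l) →
      ∃ w : (openGraph ω).Walk x ((x :: l).getLast (by simp)), w.length = l.length := by
  induction l with
  | nil => exact fun x _ => ⟨.nil, rfl⟩
  | cons a l ih =>
    intro x h
    rw [List.isChain_cons_cons] at h
    obtain ⟨w, hw⟩ := ih a h.2
    exact ⟨.cons (show (openGraph ω).Adj x a from h.1)
      (w.copy rfl (List.getLast_cons (by simp)).symm), by simp [hw]⟩

lemma exists_isChain_of_walk {ω : Config d} {x y : Vert d} (w : (openGraph ω).Walk x y) :
    ∃ l : List (Vert d), List.IsChain (edgeOpen ω) (x :: l) ∧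
      (x :: l).getLast (by simp) = y ∧ w.length = l.length := by
  induction w with
  | nil => exact ⟨[], by simp⟩
  | @cons u v t h w ih =>
    obtain ⟨l, hl, hy, hn⟩ := ih
    refine ⟨v :: l, List.isChain_cons_cons.2 ⟨h, hl⟩, ?_, by simp [hn]⟩
    rw [List.getLast_cons (by simp), hy]

lemma chemDist_eq_edist (ω : Config d) (x y : Vert d) :
    chemDist ω x y = (openGraph ω).edist x y := by
  refine le_antisymm (le_iInf fun w => ?_) (le_sInf ?_)
  · obtain ⟨l, hl, hy, hn⟩ := exists_isChain_of_walk w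
    exact sInf_le ⟨l, hl, hy, by rw [hn]⟩
  · rintro n ⟨l, hl, rfl, rfl⟩
    obtain ⟨w, hw⟩ := exists_walk_of_isChain l x hl
    rw [← hw]
    exact SimpleGraph.edist_le w

lemma chemDist_le_iff {ω : Config d} {x y : Vert d} {n : ℕ} :
    chemDist ω x y ≤ n ↔ ∃ w : (openGraph ω).Walk x y, w.length ≤ n := by
  rw [chemDist_eq_edist]
  refine ⟨fun h => ?_, fun ⟨w, hw⟩ => (SimpleGraph.edist_le w).trans (by exact_mod_cast hw)⟩
  have hr : (openGraph ω).Reachable x y :=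
    SimpleGraph.reachable_of_edist_ne_top (ne_top_of_le_ne_top (by simp) h)
  obtain ⟨w, hw⟩ := hr.exists_walk_length_eq_edist
  exact ⟨w, by rw [← hw] at h; exact_mod_cast h⟩

lemma conn_iff_reachable {ω : Config d} {x y : Vert d} :
    Conn ω x y ↔ (openGraph ω).Reachable x y := by
  rw [Conn, chemDist_eq_edist]
  exact SimpleGraph.edist_ne_top_iff_reachable

lemma Conn.symm {ω : Config d} {x y : Vert d} (h : Conn ω x y) : Conn ω y x :=
  conn_iff_reachable.2 (conn_iff_reachable.1 h).symm

lemma Conn.trans {ω : Config d} {x y z : Vert d} (h : Conn ω x y) (h' : Conn ω y z) :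
    Conn ω x z :=
  conn_iff_reachable.2 ((conn_iff_reachable.1 h).trans (conn_iff_reachable.1 h'))

lemma Conn.refl (ω : Config d) (x : Vert d) : Conn ω x x :=
  conn_iff_reachable.2 (SimpleGraph.Reachable.refl x)

lemma chemDist_comm (ω : Config d) (x y : Vert d) : chemDist ω x y = chemDist ω y x := by
  simp only [chemDist_eq_edist, SimpleGraph.edist_comm]

lemma chemDist_triangle (ω : Config d) (x y z : Vert d) :
    chemDist ω x z ≤ chemDist ω x y + chemDist ω y z := by
  simp only [chemDist_eq_edist]
  exact SimpleGraph.edist_triangle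

/-- `Conn` together with a bound on the real-valued distance is a bound on the distance. -/
lemma conn_and_chemDistR_le_iff {ω : Config d} {x y : Vert d} {t : ℝ} (ht : 0 ≤ t) :
    Conn ω x y ∧ chemDistR ω x y ≤ t ↔ chemDist ω x y ≤ (⌊t⌋₊ : ℕ∞) := by
  unfold Conn chemDistR
  induction chemDist ω x y using ENat.recTopCoe with
  | top => simp
  | coe n => simpa using (Nat.le_floor_iff ht).symm

/-! ### Local events -/

lemma finite_ballE (c : Vert d) (n : ℕ) :
    {e : EdgeT d | ∀ v ∈ e.1, dist1 v c ≤ n}.Finite := by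
  have hf := finite_dist1_le c n
  refine Set.Finite.of_finite_image (f := Subtype.val) ?_ Subtype.val_injective.injOn
  refine ((hf.prod hf).image fun q => s(q.1, q.2)).subset ?_
  rintro _ ⟨e, he, rfl⟩
  obtain ⟨x, y, -, hxy⟩ := e.2
  exact ⟨(x, y), ⟨he x (by simp [hxy]), he y (by simp [hxy])⟩, hxy.symm⟩

/-- The edges of the `ℓ¹` ball of radius `n` about `c`. -/
noncomputable def ballE (c : Vert d) (n : ℕ) : Finset (EdgeT d) := (finite_ballE c n).toFinset

lemma mem_ballE {c : Vert d} {n : ℕ} {e : EdgeT d} :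
    e ∈ ballE c n ↔ ∀ v ∈ e.1, dist1 v c ≤ n := by
  simp [ballE]

lemma ballE_subset {c c' : Vert d} {n n' : ℕ} (h : dist1 c c' + n ≤ n') :
    ballE c n ⊆ ballE c' n' := by
  intro e he
  rw [mem_ballE] at he ⊢
  intro v hv
  have := he v hv
  have := dist1_triangle v c c'
  omega

lemma disjoint_ballE {c c' : Vert d} {n n' : ℕ} (h : (n + n' : ℤ) < dist1 c c') :
    Disjoint (ballE c n) (ballE c' n') := by
  rw [Finset.disjoint_left]
  intro e he he'
  rw [mem_ballE] at he he'
  obtain ⟨x, y, -, hxy⟩ := e.2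
  have h1 := he x (by simp [hxy])
  have h2 := he' x (by simp [hxy])
  have h3 := dist1_triangle c x c'
  rw [dist1_comm c x] at h3
  omega

lemma edgeOpen_congr {ω ω' : Config d} {c : Vert d} {n : ℕ} (h : ∀ e ∈ ballE c n, ω e = ω' e)
    {x y : Vert d} (hx : dist1 x c ≤ n) (hy : dist1 y c ≤ n) (ho : edgeOpen ω x y) :
    edgeOpen ω' x y := by
  obtain ⟨ha, ho⟩ := ho
  refine ⟨ha, ?_⟩
  rw [← h _ (mem_ballE.2 ?_), ho]
  intro v hv
  rcases Sym2.mem_iff.1 hv with rfl | rfl <;> assumption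

lemma dist1_le_of_edgeOpen {ω : Config d} {x y : Vert d} (h : edgeOpen ω x y) (c : Vert d) :
    dist1 y c ≤ dist1 x c + 1 := by
  have h1 : dist1 x y = 1 := h.1
  have := dist1_triangle y x c
  rw [dist1_comm y x] at this
  omega

lemma exists_walk_of_agree {ω ω' : Config d} {c : Vert d} {n : ℕ}
    (h : ∀ e ∈ ballE c n, ω e = ω' e) {x y : Vert d} (w : (openGraph ω).Walk x y)
    (hw : dist1 x c + w.length ≤ n) :
    ∃ w' : (openGraph ω').Walk x y, w'.length = w.length := by
  induction w with
  | nil => exact ⟨.nil, rfl⟩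
  | @cons u v t ha w ih =>
    rw [SimpleGraph.Walk.length_cons] at hw
    push_cast at hw
    have h1 := dist1_le_of_edgeOpen ha c
    obtain ⟨w', hw'⟩ := ih (by omega)
    have ha' : (openGraph ω').Adj u v := edgeOpen_congr h (by omega) (by omega) ha
    exact ⟨.cons ha' w', by rw [SimpleGraph.Walk.length_cons, SimpleGraph.Walk.length_cons, hw']⟩

lemma chemDist_le_congr {ω ω' : Config d} {c : Vert d} {n m : ℕ}
    (h : ∀ e ∈ ballE c n, ω e = ω' e) {x y : Vert d} (hx : dist1 x c + m ≤ n) :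
    chemDist ω x y ≤ m ↔ chemDist ω' x y ≤ m := by
  simp only [chemDist_le_iff]
  constructor
  · rintro ⟨w, hw⟩
    obtain ⟨w', hw'⟩ := exists_walk_of_agree h w (by omega)
    exact ⟨w', hw'.trans_le hw⟩
  · rintro ⟨w, hw⟩
    obtain ⟨w', hw'⟩ := exists_walk_of_agree (fun e he => (h e he).symm) w (by omega)
    exact ⟨w', hw'.trans_le hw⟩

/-- `y` is connected to the `ℓ¹` sphere of radius `n` about `c`. -/
def Reaches (ω : Config d) (c : Vert d) (n : ℕ) (y : Vert d) : Prop :=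
  ∃ z : Vert d, dist1 z c = (n : ℤ) ∧ Conn ω y z

lemma reaches_of_walk {ω ω' : Config d} {c : Vert d} {n : ℕ}
    (h : ∀ e ∈ ballE c n, ω e = ω' e) {y z : Vert d} (w : (openGraph ω).Walk y z)
    (hy : dist1 y c ≤ n) (hz : n ≤ dist1 z c) : Reaches ω' c n y := by
  induction w with
  | nil => exact ⟨_, le_antisymm hy hz, Conn.refl _ _⟩
  | @cons u v t ha w ih =>
    rcases hy.eq_or_lt with hu | hu
    · exact ⟨u, hu, Conn.refl _ _⟩
    · have h1 := dist1_le_of_edgeOpen ha c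
      obtain ⟨z', hz', hc⟩ := ih (by omega) hz
      have ha' : (openGraph ω').Adj u v := edgeOpen_congr h hy (by omega) ha
      exact ⟨z', hz', (conn_iff_reachable.2 ha'.reachable).trans hc⟩

lemma reaches_of_conn {ω : Config d} {c y z : Vert d} {n : ℕ} (hc : Conn ω y z)
    (hy : dist1 y c ≤ n) (hz : n ≤ dist1 z c) : Reaches ω c n y := by
  obtain ⟨w⟩ := conn_iff_reachable.1 hc
  exact reaches_of_walk (fun _ _ => rfl) w hy hz

lemma Reaches.congr {ω ω' : Config d} {c y : Vert d} {n : ℕ}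
    (h : ∀ e ∈ ballE c n, ω e = ω' e) (hy : dist1 y c ≤ n) (hr : Reaches ω c n y) :
    Reaches ω' c n y := by
  obtain ⟨z, hz, hc⟩ := hr
  obtain ⟨w⟩ := conn_iff_reachable.1 hc
  exact reaches_of_walk h w hy hz.ge

lemma InfCluster.reaches {ω : Config d} {y : Vert d} (h : InfCluster ω y) {c : Vert d} {n : ℕ}
    (hy : dist1 y c ≤ n) : Reaches ω c n y := by
  obtain ⟨z, hz, hzn⟩ := h.exists_notMem_finset (finite_dist1_le c n).toFinset
  rw [Set.Finite.mem_toFinset, Set.mem_ofPred_eq, not_le] at hzn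
  exact reaches_of_conn hz hy hzn.le

lemma infCluster_of_forall_reaches {ω : Config d} {y c : Vert d}
    (h : ∀ n : ℕ, ∃ m, n ≤ m ∧ Reaches ω c m y) : InfCluster ω y := by
  intro hf
  obtain ⟨b, hb⟩ := (hf.image fun z => dist1 z c).bddAbove
  obtain ⟨m, hm, z, hz, hc⟩ := h (b.toNat + 1)
  have := hb ⟨z, hc, rfl⟩
  simp only at this
  omega

lemma infCluster_iff {ω : Config d} {y : Vert d} :
    InfCluster ω y ↔ ∀ n : ℕ, Reaches ω y n y :=
  ⟨fun h n => h.reaches (by rw [dist1_self]; omega),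
    fun h => infCluster_of_forall_reaches fun n => ⟨n, le_rfl, h n⟩⟩

lemma dependsOn_reaches {c y : Vert d} {n : ℕ} (hy : dist1 y c ≤ n) :
    DependsOn (fun ω => ω ∈ {ω : Config d | Reaches ω c n y}) (ballE c n : Set (EdgeT d)) := by
  intro ω ω' h
  exact propext ⟨Reaches.congr (fun e he => h e he) hy,
    Reaches.congr (fun e he => (h e he).symm) hy⟩

lemma measurableSet_reaches {c y : Vert d} {n : ℕ} (hy : dist1 y c ≤ n) :
    MeasurableSet {ω : Config d | Reaches ω c n y} :=
  measurableSet_of_dependsOn (dependsOn_reaches hy)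

lemma measurableSet_infCluster (y : Vert d) : MeasurableSet {ω : Config d | InfCluster ω y} := by
  have : {ω : Config d | InfCluster ω y} = ⋂ n : ℕ, {ω : Config d | Reaches ω y n y} := by
    ext ω
    simp [infCluster_iff]
  rw [this]
  exact MeasurableSet.iInter fun n => measurableSet_reaches (by rw [dist1_self]; omega)

lemma measurableSet_chemDist_le (x y : Vert d) (n : ℕ) :
    MeasurableSet {ω : Config d | chemDist ω x y ≤ n} := by
  refine measurableSet_of_dependsOn (F := ballE x n) fun ω ω' h => propext ?_
  exact chemDist_le_congr (fun e he => h e he) (by rw [dist1_self]; omega)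

/-! ### Symmetries of the lattice -/

/-- The action on edges of an isometry of the lattice. -/
def edgeMap (φ : Vert d ≃ Vert d) (hφ : ∀ x y, dist1 (φ x) (φ y) = dist1 x y) (e : EdgeT d) :
    EdgeT d :=
  ⟨e.1.map φ, by
    obtain ⟨x, y, h, hxy⟩ := e.2
    exact ⟨φ x, φ y, (hφ x y).trans h, by rw [hxy, Sym2.map_mk]⟩⟩

lemma edgeMap_injective (φ : Vert d ≃ Vert d) (hφ : ∀ x y, dist1 (φ x) (φ y) = dist1 x y) :
    Function.Injective (edgeMap φ hφ) := by
  intro e e' h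
  exact Subtype.ext (Sym2.map.injective φ.injective (congrArg Subtype.val h))

/-- The pull-back of a configuration by an isometry of the lattice. -/
def pull (φ : Vert d ≃ Vert d) (hφ : ∀ x y, dist1 (φ x) (φ y) = dist1 x y) (ω : Config d) :
    Config d := fun e => ω (edgeMap φ hφ e)

section Pull

variable (φ : Vert d ≃ Vert d) (hφ : ∀ x y, dist1 (φ x) (φ y) = dist1 x y)

lemma edgeOpen_pull (ω : Config d) (x y : Vert d) :
    edgeOpen (pull φ hφ ω) x y ↔ edgeOpen ω (φ x) (φ y) := by
  constructor
  · rintro ⟨h, ho⟩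
    exact ⟨(hφ x y).trans h, ho⟩
  · rintro ⟨h, ho⟩
    exact ⟨(hφ x y).symm.trans h, ho⟩

lemma chemDist_pull (ω : Config d) (x y : Vert d) :
    chemDist (pull φ hφ ω) x y = chemDist ω (φ x) (φ y) := by
  let f : openGraph (pull φ hφ ω) ≃g openGraph ω :=
    ⟨φ, fun {a b} => (edgeOpen_pull φ hφ ω a b).symm⟩
  refine le_antisymm ?_ ?_
  · rw [chemDist_eq_edist, chemDist_eq_edist]
    refine le_iInf fun w => ?_
    have := SimpleGraph.edist_le
      ((w.map f.symm.toHom).copy (f.symm_apply_apply x) (f.symm_apply_apply y))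
    simpa using this
  · rw [chemDist_eq_edist, chemDist_eq_edist]
    refine le_iInf fun w => ?_
    exact (SimpleGraph.edist_le (w.map f.toHom)).trans_eq (by simp)

lemma conn_pull {ω : Config d} {x y : Vert d} :
    Conn (pull φ hφ ω) x y ↔ Conn ω (φ x) (φ y) := by
  rw [Conn, Conn, chemDist_pull]

lemma chemDistR_pull (ω : Config d) (x y : Vert d) :
    chemDistR (pull φ hφ ω) x y = chemDistR ω (φ x) (φ y) := by
  rw [chemDistR, chemDistR, chemDist_pull]

lemma infCluster_pull {ω : Config d} {x : Vert d} :
    InfCluster (pull φ hφ ω) x ↔ InfCluster ω (φ x) := by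
  have : cluster (pull φ hφ ω) x = φ ⁻¹' cluster ω (φ x) := by
    ext y
    exact conn_pull φ hφ
  rw [InfCluster, InfCluster, this]
  rw [← Set.infinite_image_iff φ.injective.injOn, Equiv.image_preimage]

lemma measurePreserving_pull (p : unitInterval) :
    MeasurePreserving (pull φ hφ) (prodBern fun _ => p) (prodBern fun _ => p) :=
  ⟨measurable_pi_lambda _ fun _ => measurable_pi_apply _,
    map_prodBern_of_injective p (edgeMap_injective φ hφ)⟩

end Pull

end Lattice

/-! ### Translations, signed permutations and the regularised points -/

section Points

variable {d : ℕ}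

lemma dist1_addRight (t x y : Vert d) :
    dist1 (Equiv.addRight t x) (Equiv.addRight t y) = dist1 x y :=
  dist1_add_right x y t

/-- The translate of a configuration, seen from `t`. -/
def shift (t : Vert d) (ω : Config d) : Config d := pull (Equiv.addRight t) (dist1_addRight t) ω

lemma chemDist_shift (t : Vert d) (ω : Config d) (x y : Vert d) :
    chemDist (shift t ω) x y = chemDist ω (x + t) (y + t) := chemDist_pull _ _ ω x y

lemma chemDistR_shift (t : Vert d) (ω : Config d) (x y : Vert d) :
    chemDistR (shift t ω) x y = chemDistR ω (x + t) (y + t) := chemDistR_pull _ _ ω x y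

lemma conn_shift {t : Vert d} {ω : Config d} {x y : Vert d} :
    Conn (shift t ω) x y ↔ Conn ω (x + t) (y + t) := conn_pull _ _

lemma infCluster_shift {t : Vert d} {ω : Config d} {x : Vert d} :
    InfCluster (shift t ω) x ↔ InfCluster ω (x + t) := infCluster_pull _ _

lemma reaches_shift {t : Vert d} {ω : Config d} {c y : Vert d} {n : ℕ} :
    Reaches (shift t ω) c n y ↔ Reaches ω (c + t) n (y + t) := by
  constructor
  · rintro ⟨z, hz, hc⟩
    exact ⟨z + t, (dist1_add_right z c t).trans hz, conn_shift.1 hc⟩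
  · rintro ⟨z, hz, hc⟩
    refine ⟨z - t, ?_, conn_shift.2 (by rwa [sub_add_cancel])⟩
    rw [← dist1_add_right _ _ t, sub_add_cancel, hz]

lemma measurePreserving_shift (p : unitInterval) (t : Vert d) :
    MeasurePreserving (shift t) (prodBern fun _ => p) (prodBern fun _ => p) :=
  measurePreserving_pull _ _ p

lemma measureReal_preimage_le {α β : Type*} [MeasurableSpace α] [MeasurableSpace β] {μ : Measure α}
    {ν : Measure β} [IsFiniteMeasure ν] {f : α → β} (hf : MeasurePreserving f μ ν) (s : Set β) :
    μ.real (f ⁻¹' s) ≤ ν.real s := by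
  refine ENNReal.toReal_mono (measure_ne_top ν s) ?_
  rw [← hf.map_eq]
  exact Measure.le_map_apply hf.measurable.aemeasurable s

lemma IsSignedPermZ.dist1_eq {g : Vert d → Vert d} (hg : IsSignedPermZ g) (x y : Vert d) :
    dist1 (g x) (g y) = dist1 x y := by
  obtain ⟨σ, ε, hε, hg⟩ := hg
  unfold dist1
  rw [← Equiv.sum_comp σ fun i => |x i - y i|]
  refine Finset.sum_congr rfl fun i _ => ?_
  rw [hg, hg, ← mul_sub, abs_mul]
  rcases hε i with h | h <;> simp [h]

lemma IsSignedPermZ.bijective {g : Vert d → Vert d} (hg : IsSignedPermZ g) :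
    Function.Bijective g := by
  refine ⟨fun x y h => dist1_eq_zero.1 ?_, fun x => ?_⟩
  · rw [← hg.dist1_eq, h, dist1_self]
  · obtain ⟨σ, ε, hε, hg⟩ := hg
    refine ⟨fun j => ε (σ.symm j) * x (σ.symm j), funext fun i => ?_⟩
    rw [hg, Equiv.symm_apply_apply]
    rcases hε i with h | h <;> simp [h]

lemma IsSignedPermZ.map_nsmul {g : Vert d → Vert d} (hg : IsSignedPermZ g) (k : ℕ) (x : Vert d) :
    g (k • x) = k • g x := by
  obtain ⟨σ, ε, -, hg⟩ := hg
  ext i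
  rw [hg, Pi.smul_apply, Pi.smul_apply, hg, mul_smul_comm]

lemma IsSignedPermZ.map_zero {g : Vert d → Vert d} (hg : IsSignedPermZ g) : g 0 = 0 := by
  simpa using hg.map_nsmul 0 0

lemma lexLE_antisymm {a b : Vert d} (h : lexLE a b) (h' : lexLE b a) : a = b := by
  rcases h with h | ⟨i, hi, hi'⟩
  · exact h
  rcases h' with h | ⟨j, hj, hj'⟩
  · exact h.symm
  rcases lt_trichotomy i j with h | rfl | h
  · have := hj' i h; omega
  · omega
  · have := hi' j h; omega

lemma keyLE_antisymm {c a b : Vert d} (h : keyLE c a b) (h' : keyLE c b a) : a = b := by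
  rcases h with h | ⟨h, hl⟩ <;> rcases h' with h' | ⟨h', hl'⟩
  · omega
  · omega
  · omega
  · exact lexLE_antisymm hl hl'

lemma keyLE_add_right {c a b t : Vert d} (h : keyLE c a b) : keyLE (c + t) (a + t) (b + t) := by
  unfold keyLE at h ⊢
  rw [dist1_add_right, dist1_add_right]
  refine h.imp_right fun h => ⟨h.1, ?_⟩
  rcases h.2 with rfl | ⟨i, hi, hj⟩
  · exact Or.inl rfl
  · exact Or.inr ⟨i, by simpa using hi, fun j hji => by simpa using hj j hji⟩

lemma sqrt_natCast_le (N : ℕ) : Real.sqrt N ≤ N := by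
  rw [Real.sqrt_le_left (by positivity)]
  exact_mod_cast Nat.le_self_pow two_ne_zero N

lemma mem_calI {ω : Config d} {x : Vert d} {N : ℕ} {y : Vert d} :
    y ∈ calI ω x N ↔ ((dist1 y (N • x) : ℤ) : ℝ) ≤ Real.sqrt N ∧ Reaches ω (N • x) N y := Iff.rfl

lemma dist1_le_of_le_sqrt {y c : Vert d} {N : ℕ} (h : ((dist1 y c : ℤ) : ℝ) ≤ Real.sqrt N) :
    dist1 y c ≤ N := by
  exact_mod_cast h.trans (sqrt_natCast_le N)

lemma calI_congr {ω ω' : Config d} {x : Vert d} {N : ℕ}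
    (h : ∀ e ∈ ballE (N • x) N, ω e = ω' e) : calI ω x N = calI ω' x N := by
  ext y
  rw [mem_calI, mem_calI]
  exact and_congr_right fun hy => ⟨Reaches.congr h (dist1_le_of_le_sqrt hy),
    Reaches.congr (fun e he => (h e he).symm) (dist1_le_of_le_sqrt hy)⟩

lemma mem_calI_shift {ω : Config d} {x a : Vert d} {N : ℕ} {y : Vert d} :
    y ∈ calI (shift (N • a) ω) x N ↔ y + N • a ∈ calI ω (x + a) N := by
  rw [mem_calI, mem_calI, reaches_shift, smul_add, dist1_add_right]

namespace IpointSpec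

variable {I : Config d → Vert d → ℕ → Vert d}

lemma eq_of_mem (hI : IpointSpec I) {ω : Config d} {x : Vert d} {N : ℕ} {y : Vert d}
    (hy : y ∈ calI ω x N)
    (hmin : ∀ z ∈ calI ω x N, keyLE (N • x) y z) : I ω x N = y :=
  have h := (hI ω x N).2 ⟨y, hy⟩
  keyLE_antisymm (h.2 y hy) (hmin _ h.1)

lemma congr (hI : IpointSpec I) {ω ω' : Config d} {x : Vert d} {N : ℕ}
    (h : calI ω x N = calI ω' x N) :
    I ω x N = I ω' x N := by
  rcases (calI ω x N).eq_empty_or_nonempty with he | hne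
  · rw [(hI ω x N).1 he, (hI ω' x N).1 (h ▸ he)]
  · have h' := (hI ω' x N).2 (h ▸ hne)
    exact hI.eq_of_mem (h ▸ h'.1) (h ▸ h'.2)

lemma apply_shift (hI : IpointSpec I) (ω : Config d) (x a : Vert d) (N : ℕ) :
    I (shift (N • a) ω) x N + N • a = I ω (x + a) N := by
  rcases (calI (shift (N • a) ω) x N).eq_empty_or_nonempty with he | hne
  · have he' : calI ω (x + a) N = ∅ := by
      refine Set.eq_empty_of_forall_notMem fun y hy => ?_
      have : y - N • a ∈ calI (shift (N • a) ω) x N := mem_calI_shift.2 (by rwa [sub_add_cancel])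
      rw [he] at this
      exact this
    rw [(hI _ x N).1 he, (hI ω (x + a) N).1 he', smul_add]
  · have h := (hI _ x N).2 hne
    refine (hI.eq_of_mem (mem_calI_shift.1 h.1) fun z hz => ?_).symm
    have h1 := keyLE_add_right (t := N • a)
      (h.2 (z - N • a) (mem_calI_shift.2 (by rwa [sub_add_cancel])))
    rwa [sub_add_cancel, ← smul_add] at h1

lemma dist1_le (hI : IpointSpec I) (ω : Config d) (x : Vert d) (N : ℕ) :
    dist1 (I ω x N) (N • x) ≤ N := by
  rcases (calI ω x N).eq_empty_or_nonempty with he | hne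
  · rw [(hI ω x N).1 he, dist1_self]; omega
  · exact dist1_le_of_le_sqrt ((hI ω x N).2 hne).1.1

lemma dependsOn_chemDist_le (hI : IpointSpec I) (x y : Vert d) (N m : ℕ) :
    DependsOn (fun ω => chemDist ω (I ω x N) (I ω y N) ≤ m)
      ((ballE (N • x) (N + m) ∪ ballE (N • y) N : Finset (EdgeT d)) : Set (EdgeT d)) := by
  intro ω ω' h
  have hx : ∀ e ∈ ballE (N • x) (N + m), ω e = ω' e := fun e he =>
    h e (Finset.mem_coe.2 (Finset.mem_union_left _ he))
  have hx' : ∀ e ∈ ballE (N • x) N, ω e = ω' e :=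
    fun e he => hx e (ballE_subset (by rw [dist1_self]; push_cast; omega) he)
  have hy : ∀ e ∈ ballE (N • y) N, ω e = ω' e := fun e he =>
    h e (Finset.mem_coe.2 (Finset.mem_union_right _ he))
  have h1 := hI.dist1_le ω x N
  simp only [eq_iff_iff]
  rw [chemDist_le_congr (m := m) hx (by push_cast; omega), hI.congr (calI_congr hx'),
    hI.congr (calI_congr hy)]

lemma measurableSet_chemDist_le (hI : IpointSpec I) (x y : Vert d) (N m : ℕ) :
    MeasurableSet {ω | chemDist ω (I ω x N) (I ω y N) ≤ m} :=
  measurableSet_of_dependsOn (hI.dependsOn_chemDist_le x y N m)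

lemma chemDist_shift (hI : IpointSpec I) (ω : Config d) (x y a : Vert d) (N : ℕ) :
    chemDist (shift (N • a) ω) (I (shift (N • a) ω) x N) (I (shift (N • a) ω) y N) =
      chemDist ω (I ω (x + a) N) (I ω (y + a) N) := by
  rw [ChemDist.chemDist_shift, hI.apply_shift, hI.apply_shift]

end IpointSpec

end Points

/-! ### Supercritical percolation -/

section Supercritical

variable {d : ℕ}

lemma edgeOpen_mono {ω ω' : Config d} (h : ω ≤ ω') {x y : Vert d} (ho : edgeOpen ω x y) :
    edgeOpen ω' x y := by
  obtain ⟨ha, ho⟩ := ho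
  refine ⟨ha, ?_⟩
  have := h ⟨s(x, y), x, y, ha, rfl⟩
  rw [ho] at this
  exact top_le_iff.1 this

lemma Conn.mono {ω ω' : Config d} (h : ω ≤ ω') {x y : Vert d} (hc : Conn ω x y) :
    Conn ω' x y :=
  conn_iff_reachable.2 ((conn_iff_reachable.1 hc).mono fun _ _ ho => edgeOpen_mono h ho)

lemma InfCluster.mono {ω ω' : Config d} (h : ω ≤ ω') {x : Vert d} (hi : InfCluster ω x) :
    InfCluster ω' x :=
  Set.Infinite.mono (fun _ hc => Conn.mono h hc) hi

lemma infCluster_of_forall_eq_true (hd : 0 < d) {ω : Config d} (h : ∀ e, ω e = true) :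
    InfCluster ω 0 := by
  set e₀ : Vert d := Pi.single ⟨0, hd⟩ 1
  have hc : ∀ k : ℕ, Conn ω 0 (k • e₀) := by
    intro k
    induction k with
    | zero => rw [zero_smul]; exact Conn.refl _ _
    | succ k ih =>
      refine ih.trans (conn_iff_reachable.2 (SimpleGraph.Adj.reachable ?_))
      refine ⟨?_, h _⟩
      show dist1 (k • e₀) ((k + 1) • e₀) = 1
      rw [add_smul, one_smul, dist1_comm]
      simp [dist1, e₀, Pi.single_apply, apply_ite abs]
  refine Set.infinite_of_injective_forall_mem (f := fun k : ℕ => k • e₀) (fun a b hab => ?_) hc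
  have := congrFun hab ⟨0, hd⟩
  simpa [e₀] using this

lemma pc_nonneg : 0 ≤ pc d := Real.sInf_nonneg fun _ h => h.1.1

lemma infCluster_pos_of_pc_lt (hd : 0 < d) {p : unitInterval} (hp : pc d < p) :
    0 < (prodBern fun _ : EdgeT d => p).real {ω | InfCluster ω 0} := by
  have hne : {p : ℝ | p ∈ Set.Icc (0 : ℝ) 1 ∧
      ∀ P : Measure (Config d), IsProductBernoulli p P → 0 < P {ω | InfCluster ω 0}}.Nonempty := by
    refine ⟨1, ⟨zero_le_one, le_rfl⟩, fun P hP => ?_⟩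
    have := hP.1
    have h1 : ∀ᵐ ω ∂P, ∀ e : EdgeT d, ω e = true := by
      rw [ae_all_iff]
      intro e
      have := hP.2 {e} fun _ => false
      simpa [ae_iff] using this
    have h2 : ∀ᵐ ω ∂P, ω ∈ {ω : Config d | InfCluster ω 0} := by
      filter_upwards [h1] with ω h using infCluster_of_forall_eq_true hd h
    have h3 : P {ω : Config d | InfCluster ω 0} = P Set.univ :=
      measure_congr (eventuallyEq_univ.2 h2)
    rw [h3, measure_univ]
    exact one_pos
  obtain ⟨q, ⟨hq, hqP⟩, hqp⟩ := exists_lt_of_csInf_lt hne hp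
  lift q to unitInterval using hq
  have hA := measurableSet_infCluster (d := d) 0
  have key := integral_prodBern_le_of_cond (ν := prodBern fun _ : EdgeT d => p) (q := q)
    (f := ({ω | InfCluster ω 0} : Set (Config d)).indicator 1) (C := 1) ?_
    (measurable_const.indicator hA) ?_ ?_
  · rw [integral_indicator_one hA, integral_indicator_one hA] at key
    refine lt_of_lt_of_le ?_ key
    exact ENNReal.toReal_pos (hqP _ (isProductBernoulli_prodBern q)).ne' (measure_ne_top _ _)
  · intro S v hv z
    rw [measure_inter_of_dependsOn _ (Finset.disjoint_singleton_right.2 hv)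
      (dependsOn_cylinder S z) (dependsOn_apply_eq v false), mul_comm]
    have h1 := prodBern_real_cylinder (fun _ : EdgeT d => p) {v} fun _ => false
    simp only [Finset.mem_singleton, forall_eq, Finset.prod_singleton, Bool.false_eq_true,
      if_false] at h1
    rw [h1]
    have : (q : ℝ) < p := hqp
    exact mul_le_mul_of_nonneg_right (by linarith) measureReal_nonneg
  · intro ω ω' h
    by_cases hω : InfCluster ω 0
    · have hω' := hω.mono h
      simp [Set.indicator, hω, hω']
    · simp only [Set.indicator, Set.mem_ofPred_eq, hω, if_false]
      split_ifs <;> simp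
  · intro ω
    by_cases hω : InfCluster ω 0 <;> simp [Set.indicator, hω]

lemma IsNorm.nonneg {μ : (Fin d → ℝ) → ℝ} (h : IsNorm μ) (x : Fin d → ℝ) : 0 ≤ μ x := by
  have h1 := h.add_le x ((-1 : ℝ) • x)
  rw [h.smul, neg_one_smul, add_neg_cancel, (h.eq_zero_iff 0).2 rfl] at h1
  norm_num at h1
  exact h1

lemma toR_ne_zero {u : Vert d} (hu : u ≠ 0) : toR u ≠ 0 := by
  contrapose! hu
  ext i
  have := congrFun hu i
  simpa [toR] using this

lemma IsNorm.pos {μ : (Fin d → ℝ) → ℝ} (h : IsNorm μ) {u : Vert d} (hu : u ≠ 0) :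
    0 < μ (toR u) :=
  lt_of_le_of_ne (h.nonneg _) fun h0 => toR_ne_zero hu ((h.eq_zero_iff _).1 h0.symm)

lemma conn_of_chemDistR_pos {ω : Config d} {x y : Vert d} (h : 0 < chemDistR ω x y) :
    Conn ω x y := by
  intro ht
  simp [chemDistR, ht] at h

/-- The multiples of `u` seen from `x` that lie in infinite clusters, and the asymptotic
upper bound on the chemical distance to them. -/
def GoodRay (μ : (Fin d → ℝ) → ℝ) (ω : Config d) (x u : Vert d) : Prop :=
  {k : ℕ | 0 < k ∧ InfCluster ω (k • u + x)}.Infinite ∧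
    ∀ c, μ (toR u) < c → ∀ᶠ k : ℕ in atTop, InfCluster ω (k • u + x) →
      Conn ω x (k • u + x) ∧ chemDistR ω x (k • u + x) ≤ k * c

lemma goodRay_shift {μ : (Fin d → ℝ) → ℝ} {ω : Config d} {x u : Vert d} :
    GoodRay μ (shift x ω) 0 u ↔ GoodRay μ ω x u := by
  simp only [GoodRay, infCluster_shift, conn_shift, chemDistR_shift, add_zero, zero_add]

lemma TimeConstant.ae_goodRay_zero {p : unitInterval} {μ : (Fin d → ℝ) → ℝ}
    (hμ : TimeConstant d p μ) :
    ∀ᵐ ω ∂(prodBern fun _ : EdgeT d => p), InfCluster ω 0 → ∀ u : Vert d, u ≠ 0 →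
      GoodRay μ ω 0 u := by
  classical
  filter_upwards [hμ.2 _ (isProductBernoulli_prodBern p)] with ω hω h0 u hu
  obtain ⟨hinf, hlim⟩ := hω h0 u hu
  refine ⟨by simpa using hinf, fun c hc => ?_⟩
  obtain ⟨n₀, hn₀⟩ := eventually_atTop.1
    ((hlim.eventually (lt_mem_nhds (hμ.1.pos hu))).and (hlim.eventually (gt_mem_nhds hc)))
  filter_upwards [eventually_gt_atTop (Nat.nth (fun k => 0 < k ∧ InfCluster ω (k • u)) n₀)]
    with k hk hik
  have hpk : 0 < k ∧ InfCluster ω (k • u) := ⟨by omega, by simpa using hik⟩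
  have hcount := (Nat.lt_nth_iff_count_lt hinf).2 hk
  have h1 := hn₀ _ hcount.le
  rw [Nat.nth_count (p := fun k => 0 < k ∧ InfCluster ω (k • u)) hpk] at h1
  have hk0 : (0 : ℝ) < k := by exact_mod_cast hpk.1
  rw [add_zero]
  refine ⟨conn_of_chemDistR_pos ?_, ?_⟩
  · have := mul_pos h1.1 hk0
    rwa [div_mul_cancel₀ _ hk0.ne'] at this
  · have := (div_lt_iff₀ hk0).1 h1.2
    linarith

lemma TimeConstant.ae_goodRay {p : unitInterval} {μ : (Fin d → ℝ) → ℝ}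
    (hμ : TimeConstant d p μ) :
    ∀ᵐ ω ∂(prodBern fun _ : EdgeT d => p), ∀ x : Vert d, InfCluster ω x →
      ∀ u : Vert d, u ≠ 0 → GoodRay μ ω x u := by
  rw [ae_all_iff]
  intro x
  filter_upwards [(measurePreserving_shift p x).quasiMeasurePreserving.ae hμ.ae_goodRay_zero]
    with ω hω hx u hu
  exact goodRay_shift.1 (hω (infCluster_shift.2 (by rwa [zero_add])) u hu)

/-- Uniqueness of the infinite cluster. -/
lemma TimeConstant.ae_conn {p : unitInterval} {μ : (Fin d → ℝ) → ℝ} (hμ : TimeConstant d p μ) :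
    ∀ᵐ ω ∂(prodBern fun _ : EdgeT d => p), ∀ x y : Vert d, InfCluster ω x → InfCluster ω y →
      Conn ω x y := by
  filter_upwards [hμ.ae_goodRay] with ω hω x y hx hy
  rcases eq_or_ne x y with rfl | hxy
  · exact Conn.refl _ _
  have hu : y - x ≠ 0 := sub_ne_zero.2 hxy.symm
  obtain ⟨hinf, hev⟩ := hω x hx (y - x) hu
  obtain ⟨-, hev'⟩ := hω y hy (y - x) hu
  obtain ⟨K, hK⟩ := eventually_atTop.1 (hev _ (lt_add_one _))
  obtain ⟨K', hK'⟩ := eventually_atTop.1 (hev' _ (lt_add_one _))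
  obtain ⟨k, ⟨-, hk⟩, hkK⟩ := hinf.exists_gt (K + K' + 1)
  have e : k • (y - x) + x = (k - 1) • (y - x) + y := by
    obtain ⟨j, rfl⟩ : ∃ j, k = j + 1 := ⟨k - 1, by omega⟩
    rw [Nat.add_sub_cancel, add_smul, one_smul]
    abel
  have h1 := (hK k (by omega) hk).1
  have h2 := (hK' (k - 1) (by omega) (e ▸ hk)).1
  exact h1.trans (e ▸ h2.symm)

lemma TimeConstant.apply_signedPerm {p : unitInterval} {μ : (Fin d → ℝ) → ℝ}
    (hμ : TimeConstant d p μ) (hp : 0 < (prodBern fun _ : EdgeT d => p).real {ω | InfCluster ω 0})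
    {g : Vert d → Vert d} (hg : IsSignedPermZ g) (u : Vert d) : μ (toR (g u)) = μ (toR u) := by
  rcases eq_or_ne u 0 with rfl | hu
  · rw [hg.map_zero]
  have hgu : g u ≠ 0 := fun h => hu (hg.bijective.1 (h.trans hg.map_zero.symm))
  have h1 := hμ.2 _ (isProductBernoulli_prodBern p)
  let φ : Vert d ≃ Vert d := Equiv.ofBijective g hg.bijective
  have hφ : ∀ x y, dist1 (φ x) (φ y) = dist1 x y := hg.dist1_eq
  have h2 := (measurePreserving_pull φ hφ p).quasiMeasurePreserving.ae h1
  have h3 : ∃ᵐ ω ∂(prodBern fun _ : EdgeT d => p), InfCluster ω 0 := by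
    rw [frequently_ae_iff]
    exact fun h => hp.ne' (by rw [Measure.real, h, ENNReal.toReal_zero])
  obtain ⟨ω, hω, h1, h2⟩ := (h3.and_eventually (h1.and h2)).exists
  have hφ0 : φ 0 = 0 := hg.map_zero
  have hφk : ∀ k : ℕ, φ (k • u) = k • g u := fun k => hg.map_nsmul k u
  have h4 := ((h2 ((infCluster_pull φ hφ).2 (by rwa [hφ0]))) u hu).2
  simp only [infCluster_pull, chemDistR_pull, hφ0, hφk] at h4
  exact tendsto_nhds_unique (h1 hω (g u) hgu).2 h4

end Supercritical

/-! ### The regularised points are typically close -/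

section Typical

variable {d : ℕ}

lemma measurableSet_conn (x y : Vert d) : MeasurableSet {ω : Config d | Conn ω x y} := by
  have : {ω : Config d | Conn ω x y} = ⋃ n : ℕ, {ω | chemDist ω x y ≤ n} := by
    ext ω
    simp only [Set.mem_ofPred_eq, Set.mem_iUnion, Conn]
    refine ⟨fun h => ?_, fun ⟨n, hn⟩ => ne_top_of_le_ne_top (ENat.natCast_ne_top n) hn⟩
    obtain ⟨n, hn⟩ := ENat.ne_top_iff_exists.1 h
    exact ⟨n, hn.ge⟩
  rw [this]
  exact MeasurableSet.iUnion fun n => measurableSet_chemDist_le x y n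

lemma measurable_infCluster (y : Vert d) : Measurable fun ω : Config d => InfCluster ω y :=
  measurableSet_setOfPred.1 (measurableSet_infCluster y)

lemma measurable_chemDist_le (x y : Vert d) (n : ℕ) :
    Measurable fun ω : Config d => chemDist ω x y ≤ n :=
  measurableSet_setOfPred.1 (measurableSet_chemDist_le x y n)

lemma measurable_reaches (c y : Vert d) (n : ℕ) : Measurable fun ω : Config d => Reaches ω c n y :=
  Measurable.exists fun z =>
    measurable_const.and (measurableSet_setOfPred.1 (measurableSet_conn y z))

lemma tendsto_measureReal_zero {Ω : Type*} [MeasurableSpace Ω] {P : Measure Ω} [IsFiniteMeasure P]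
    {S : ℕ → Set Ω} (hS : ∀ n, MeasurableSet (S n)) (h : ∀ᵐ ω ∂P, ∀ᶠ n in atTop, ω ∉ S n) :
    Tendsto (fun n => P.real (S n)) atTop (nhds 0) := by
  have := tendsto_measure_of_ae_tendsto_indicator_of_isFiniteMeasure (μ := P) atTop
    MeasurableSet.empty hS (by simpa using h)
  rw [measure_empty] at this
  exact (ENNReal.tendsto_toReal ENNReal.zero_ne_top).comp this

lemma eventually_not_reaches {ω : Config d} {c y : Vert d} (h : ¬ InfCluster ω y) :
    ∀ᶠ n in atTop, ¬ Reaches ω c n y := by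
  by_contra hcon
  refine h (infCluster_of_forall_reaches (c := c) fun n => ?_)
  obtain ⟨m, hm, hr⟩ := (frequently_atTop.1 hcon) n
  exact ⟨m, hm, hr⟩

lemma sub_le_dist1_nsmul {u : Vert d} (hu : u ≠ 0) (a b : ℕ) :
    (b : ℤ) - a ≤ dist1 (a • u) (b • u) := by
  obtain ⟨i, hi⟩ := Function.ne_iff.1 hu
  refine le_trans ?_ (abs_sub_le_dist1 _ _ i)
  rw [Pi.smul_apply, Pi.smul_apply, nsmul_eq_mul, nsmul_eq_mul, ← sub_mul, abs_mul, abs_sub_comm]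
  have h1 : 1 ≤ |u i| := Int.one_le_abs hi
  nlinarith [le_abs_self ((b : ℤ) - a), abs_nonneg ((b : ℤ) - a)]

lemma dist1_nsmul_zero (u : Vert d) (a : ℕ) : dist1 (a • u) 0 = a * dist1 u 0 := by
  simp [dist1, abs_mul, Finset.mul_sum]

section Measure

variable {p : unitInterval}

lemma measureReal_infCluster_le (x : Vert d) :
    (prodBern fun _ : EdgeT d => p).real {ω | InfCluster ω 0} ≤
      (prodBern fun _ : EdgeT d => p).real {ω | InfCluster ω x} := by
  have h := measureReal_preimage_le (measurePreserving_shift p (-x)) {ω : Config d | InfCluster ω x}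
  have e : shift (-x) ⁻¹' {ω : Config d | InfCluster ω x} = {ω | InfCluster ω 0} := by
    ext ω
    simp only [Set.mem_preimage, Set.mem_ofPred_eq, infCluster_shift, add_neg_cancel]
  rwa [e] at h

lemma measureReal_forall_not_reaches_le {u : Vert d} (hu : u ≠ 0) (n k : ℕ) :
    (prodBern fun _ : EdgeT d => p).real
        {ω | ∀ j < k, ¬ Reaches ω ((j * (2 * n + 1)) • u) n ((j * (2 * n + 1)) • u)} ≤
      (1 - (prodBern fun _ : EdgeT d => p).real {ω | InfCluster ω 0}) ^ k := by
  classical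
  set c : ℕ → Vert d := fun j => (j * (2 * n + 1)) • u
  have hself : ∀ j, dist1 (c j) (c j) ≤ n := fun j => by rw [dist1_self]; omega
  induction k with
  | zero => simp
  | succ k ih =>
    have e : {ω : Config d | ∀ j < k + 1, ¬ Reaches ω (c j) n (c j)} =
        {ω | ∀ j < k, ¬ Reaches ω (c j) n (c j)} ∩ {ω | Reaches ω (c k) n (c k)}ᶜ := by
      ext ω
      simp only [Set.mem_inter_iff, Set.mem_ofPred_eq, Set.mem_compl_iff]
      exact Nat.forall_lt_succ_right
    have hdisj : Disjoint ((Finset.range k).biUnion fun j => ballE (c j) n) (ballE (c k) n) := by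
      rw [Finset.disjoint_biUnion_left]
      intro j hj
      rw [Finset.mem_range] at hj
      refine disjoint_ballE (lt_of_lt_of_le ?_ (sub_le_dist1_nsmul hu _ _))
      push_cast
      have : (j : ℤ) + 1 ≤ k := by exact_mod_cast hj
      nlinarith
    have h1 : DependsOn (fun ω => ω ∈ {ω : Config d | ∀ j < k, ¬ Reaches ω (c j) n (c j)})
        (((Finset.range k).biUnion fun j => ballE (c j) n : Finset (EdgeT d)) :
          Set (EdgeT d)) := by
      intro ω ω' h
      refine propext (forall₂_congr fun j hj => not_congr ?_)
      refine iff_of_eq (dependsOn_reaches (hself j) fun e he => h e ?_)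
      rw [Finset.coe_biUnion]
      exact Set.mem_biUnion (by simpa using hj) he
    have h2 : DependsOn (fun ω => ω ∈ {ω : Config d | Reaches ω (c k) n (c k)}ᶜ)
        (ballE (c k) n : Set (EdgeT d)) := by
      intro ω ω' h
      exact congrArg Not (dependsOn_reaches (hself k) h)
    rw [e, measure_inter_of_dependsOn _ hdisj h1 h2, pow_succ]
    refine mul_le_mul ih ?_ measureReal_nonneg (pow_nonneg ?_ _)
    · rw [probReal_compl_eq_one_sub (measurableSet_reaches (hself k))]
      have : (prodBern fun _ : EdgeT d => p).real {ω | InfCluster ω 0} ≤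
          (prodBern fun _ : EdgeT d => p).real {ω | Reaches ω (c k) n (c k)} :=
        (measureReal_infCluster_le (c k)).trans
          (measureReal_mono fun ω hω => InfCluster.reaches hω (hself k))
      linarith
    · exact sub_nonneg.2 measureReal_le_one

lemma exists_measureReal_forall_not_infCluster_lt
    (hp : 0 < (prodBern fun _ : EdgeT d => p).real {ω | InfCluster ω 0}) {u : Vert d} (hu : u ≠ 0)
    {ε : ℝ} (hε : 0 < ε) :
    ∃ J : ℕ, (prodBern fun _ : EdgeT d => p).real {ω | ∀ j ≤ J, ¬ InfCluster ω (j • u)} < ε := by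
  obtain ⟨k, hk⟩ := exists_pow_lt_of_lt_one (half_pos hε)
    (sub_lt_self 1 hp)
  have hmeas : ∀ n, MeasurableSet {ω : Config d | Reaches ω 0 n 0 ∧ ¬ InfCluster ω 0} := fun n =>
    measurableSet_setOfPred.2 ((measurable_reaches _ _ _).and (measurable_infCluster _).not)
  have hδ := tendsto_measureReal_zero (P := prodBern fun _ : EdgeT d => p) hmeas
    (ae_of_all _ fun ω => by
    by_cases hω : InfCluster ω 0
    · exact Eventually.of_forall fun n h => h.2 hω
    · exact (eventually_not_reaches hω).mono fun n hn h => hn h.1)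
  obtain ⟨n, hn⟩ := ((hδ.const_mul (k : ℝ)).eventually
    (gt_mem_nhds (show (k : ℝ) * 0 < ε / 2 by linarith))).exists
  set c : ℕ → Vert d := fun j => (j * (2 * n + 1)) • u
  refine ⟨k * (2 * n + 1), ?_⟩
  have hsub : {ω : Config d | ∀ j ≤ k * (2 * n + 1), ¬ InfCluster ω (j • u)} ⊆
      {ω | ∀ j < k, ¬ Reaches ω (c j) n (c j)} ∪
        ⋃ j ∈ Finset.range k, shift (c j) ⁻¹' {ω | Reaches ω 0 n 0 ∧ ¬ InfCluster ω 0} := by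
    intro ω hω
    by_cases h : ∀ j < k, ¬ Reaches ω (c j) n (c j)
    · exact Or.inl h
    · push Not at h
      obtain ⟨j, hj, hr⟩ := h
      refine Or.inr (Set.mem_biUnion (Finset.mem_coe.2 (Finset.mem_range.2 hj)) ⟨?_, ?_⟩)
      · rwa [reaches_shift, zero_add]
      · rw [infCluster_shift, zero_add]
        exact hω _ (Nat.mul_le_mul_right _ hj.le)
  calc (prodBern fun _ : EdgeT d => p).real {ω | ∀ j ≤ k * (2 * n + 1), ¬ InfCluster ω (j • u)}
      ≤ _ := measureReal_mono hsub
    _ ≤ _ := measureReal_union_le _ _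
    _ ≤ (1 - (prodBern fun _ : EdgeT d => p).real {ω | InfCluster ω 0}) ^ k +
          ∑ j ∈ Finset.range k,
            (prodBern fun _ : EdgeT d => p).real {ω | Reaches ω 0 n 0 ∧ ¬ InfCluster ω 0} := by
        refine add_le_add (measureReal_forall_not_reaches_le hu n k)
          ((measureReal_biUnion_finset_le _ _).trans (Finset.sum_le_sum fun j _ => ?_))
        exact measureReal_preimage_le (measurePreserving_shift p _) _
    _ < ε := by
        rw [Finset.sum_const, Finset.card_range, nsmul_eq_mul]
        linarith

end Measure

/-- Configurations in which the neighbourhood of the origin does not look like a single infinite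
cluster meeting the ray in direction `u` early. -/
def nearBad (u : Vert d) (J L N : ℕ) : Set (Config d) :=
  {ω | ∀ j ≤ J, ¬ InfCluster ω (j • u)} ∪
    {ω | ∃ y, dist1 y 0 ≤ J * dist1 u 0 ∧ Reaches ω 0 N y ∧ ¬ InfCluster ω y} ∪
    {ω | ∃ y y', (dist1 y 0 ≤ J * dist1 u 0 ∧ dist1 y' 0 ≤ J * dist1 u 0) ∧
      (InfCluster ω y ∧ InfCluster ω y') ∧ ¬ chemDist ω y y' ≤ L}

/-- Configurations in which two points of infinite clusters on the ray in direction `u` are too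
far apart. -/
def rayBad (u : Vert d) (c : ℝ) (J N : ℕ) : Set (Config d) :=
  {ω | ∃ j j' : ℕ, (j ≤ J ∧ j' ≤ J) ∧ (InfCluster ω (j • u) ∧ InfCluster ω (j' • u + N • u)) ∧
    ¬ chemDist ω (j • u) (j' • u + N • u) ≤ (⌊(N + J) * c⌋₊ : ℕ)}

lemma measurableSet_rayBad (u : Vert d) (c : ℝ) (J N : ℕ) : MeasurableSet (rayBad u c J N) :=
  measurableSet_setOfPred.2 (Measurable.exists fun _ => Measurable.exists fun _ =>
    measurable_const.and (((measurable_infCluster _).and (measurable_infCluster _)).and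
      (measurable_chemDist_le _ _ _).not))

lemma TimeConstant.tendsto_rayBad {p : unitInterval} {μ : (Fin d → ℝ) → ℝ}
    (hμ : TimeConstant d p μ) {u : Vert d} (hu : u ≠ 0) {c : ℝ} (hc : μ (toR u) < c) (J : ℕ) :
    Tendsto (fun N => (prodBern fun _ : EdgeT d => p).real (rayBad u c J N)) atTop (nhds 0) := by
  have hc0 : 0 ≤ c := (hμ.1.nonneg _).trans hc.le
  refine tendsto_measureReal_zero (measurableSet_rayBad u c J) ?_
  filter_upwards [hμ.ae_goodRay] with ω hω
  have key : ∀ᶠ N : ℕ in atTop, ∀ j ∈ Finset.range (J + 1), ∀ j' ∈ Finset.range (J + 1),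
      InfCluster ω (j • u) → InfCluster ω (j' • u + N • u) →
      chemDist ω (j • u) (j' • u + N • u) ≤ (⌊(N + J) * c⌋₊ : ℕ) := by
    refine (Finset.eventually_all _).2 fun j hj => (Finset.eventually_all _).2 fun j' hj' => ?_
    rw [Finset.mem_range, Nat.lt_succ_iff] at hj hj'
    by_cases hinf : InfCluster ω (j • u)
    swap
    · exact Eventually.of_forall fun _ h => absurd h hinf
    have ht : Tendsto (fun N : ℕ => N + j' - j) atTop atTop :=
      tendsto_atTop_mono (fun N => by omega) (tendsto_sub_atTop_nat j)
    filter_upwards [ht.eventually ((hω _ hinf u hu).2 c hc), eventually_ge_atTop J]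
      with N hN hNJ _ hinf'
    have e : (N + j' - j) • u + j • u = j' • u + N • u := by
      rw [← add_smul, ← add_smul]
      congr 1
      omega
    rw [e] at hN
    obtain ⟨h1, h2⟩ := hN hinf'
    refine (conn_and_chemDistR_le_iff (by positivity)).1 ⟨h1, h2.trans ?_⟩
    refine mul_le_mul_of_nonneg_right ?_ hc0
    have : N + j' - j ≤ N + J := by omega
    exact_mod_cast this
  filter_upwards [key] with N hN
  rintro ⟨j, j', ⟨hj, hj'⟩, ⟨h1, h2⟩, h3⟩
  exact h3 (hN j (by simpa [Nat.lt_succ_iff] using hj) j'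
    (by simpa [Nat.lt_succ_iff] using hj') h1 h2)

lemma TimeConstant.exists_nearBad_lt {p : unitInterval} {μ : (Fin d → ℝ) → ℝ}
    (hμ : TimeConstant d p μ) (hp : 0 < (prodBern fun _ : EdgeT d => p).real {ω | InfCluster ω 0})
    {u : Vert d} (hu : u ≠ 0) {ε : ℝ} (hε : 0 < ε) :
    ∃ J L : ℕ, ∀ᶠ N in atTop, (prodBern fun _ : EdgeT d => p).real (nearBad u J L N) < ε := by
  obtain ⟨J, hJ⟩ := exists_measureReal_forall_not_infCluster_lt hp hu
    (show 0 < ε / 3 by linarith)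
  have hfin : ∀ y : Vert d, y ∈ (finite_dist1_le (0 : Vert d) (J * dist1 u 0)).toFinset ↔
      dist1 y 0 ≤ J * dist1 u 0 := fun y => by rw [Set.Finite.mem_toFinset]; rfl
  have h2 := tendsto_measureReal_zero (P := prodBern fun _ : EdgeT d => p)
    (S := fun N => {ω | ∃ y, dist1 y 0 ≤ J * dist1 u 0 ∧ Reaches ω 0 N y ∧ ¬ InfCluster ω y})
    (fun N => measurableSet_setOfPred.2 (Measurable.exists fun y => measurable_const.and
      ((measurable_reaches _ _ _).and (measurable_infCluster _).not))) (ae_of_all _ fun ω => by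
    have : ∀ᶠ N : ℕ in atTop, ∀ y ∈ (finite_dist1_le (0 : Vert d) (J * dist1 u 0)).toFinset,
        ¬ (Reaches ω 0 N y ∧ ¬ InfCluster ω y) := by
      refine (Finset.eventually_all _).2 fun y _ => ?_
      by_cases hω : InfCluster ω y
      · exact Eventually.of_forall fun n h => h.2 hω
      · exact (eventually_not_reaches hω).mono fun n hn h => hn h.1
    filter_upwards [this] with N hN
    rintro ⟨y, hy, h⟩
    exact hN y ((hfin y).2 hy) h)
  have h3 := tendsto_measureReal_zero (P := prodBern fun _ : EdgeT d => p)
    (S := fun L : ℕ => {ω | ∃ y y', (dist1 y 0 ≤ J * dist1 u 0 ∧ dist1 y' 0 ≤ J * dist1 u 0) ∧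
      (InfCluster ω y ∧ InfCluster ω y') ∧ ¬ chemDist ω y y' ≤ L})
    (fun N => measurableSet_setOfPred.2 (Measurable.exists fun _ => Measurable.exists fun _ =>
      measurable_const.and (((measurable_infCluster _).and (measurable_infCluster _)).and
        (measurable_chemDist_le _ _ _).not))) (by
    filter_upwards [hμ.ae_conn] with ω hω
    have : ∀ᶠ L : ℕ in atTop, ∀ y ∈ (finite_dist1_le (0 : Vert d) (J * dist1 u 0)).toFinset,
        ∀ y' ∈ (finite_dist1_le (0 : Vert d) (J * dist1 u 0)).toFinset,
        InfCluster ω y → InfCluster ω y' → chemDist ω y y' ≤ L := by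
      refine (Finset.eventually_all _).2 fun y _ => (Finset.eventually_all _).2 fun y' _ => ?_
      by_cases hc : Conn ω y y'
      · obtain ⟨n, hn⟩ := ENat.ne_top_iff_exists.1 hc
        filter_upwards [eventually_ge_atTop n] with L hL _ _
        rw [← hn]
        exact_mod_cast hL
      · exact Eventually.of_forall fun L h h' => absurd (hω y y' h h') hc
    filter_upwards [this] with L hL
    rintro ⟨y, y', ⟨hy, hy'⟩, ⟨h, h'⟩, hn⟩
    exact hn (hL y ((hfin y).2 hy) y' ((hfin y').2 hy') h h'))
  obtain ⟨L, hL⟩ := (h3.eventually (gt_mem_nhds (show 0 < ε / 3 by linarith))).exists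
  refine ⟨J, L, ?_⟩
  filter_upwards [h2.eventually (gt_mem_nhds (show 0 < ε / 3 by linarith))] with N hN
  unfold nearBad
  refine (measureReal_union_le _ _).trans_lt ?_
  refine (add_le_add_left (measureReal_union_le _ _) _).trans_lt ?_
  linarith

namespace IpointSpec

variable {I : Config d → Vert d → ℕ → Vert d}

lemma exists_infCluster_near (hI : IpointSpec I) {ω : Config d} {u : Vert d} {J L N : ℕ}
    (hω : ω ∉ nearBad u J L N)
    (hN : ((J * dist1 u 0 : ℤ) : ℝ) ≤ Real.sqrt N) :
    ∃ j ≤ J, InfCluster ω (j • u) ∧ chemDist ω (I ω 0 N) (j • u) ≤ L := by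
  simp only [nearBad, Set.mem_union, Set.mem_ofPred_eq, not_or] at hω
  obtain ⟨⟨h1, h2⟩, h3⟩ := hω
  push Not at h1
  obtain ⟨j, hj, hinf⟩ := h1
  have hd : dist1 (j • u) 0 ≤ J * dist1 u 0 := by
    rw [dist1_nsmul_zero]
    exact mul_le_mul_of_nonneg_right (by exact_mod_cast hj) (dist1_nonneg _ _)
  have hs : ((dist1 (j • u) (N • (0 : Vert d)) : ℤ) : ℝ) ≤ Real.sqrt N := by
    rw [smul_zero]
    exact le_trans (by exact_mod_cast hd) hN
  have hmem : j • u ∈ calI ω 0 N := mem_calI.2 ⟨hs, hinf.reaches (dist1_le_of_le_sqrt hs)⟩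
  obtain ⟨hIm, hmin⟩ := (hI ω 0 N).2 ⟨_, hmem⟩
  have hId : dist1 (I ω 0 N) 0 ≤ J * dist1 u 0 := by
    have := hmin _ hmem
    rw [smul_zero] at this
    rcases this with h | h
    · exact h.le.trans hd
    · exact h.1.le.trans hd
  have hIr := (mem_calI.1 hIm).2
  rw [smul_zero] at hIr
  have hIinf : InfCluster ω (I ω 0 N) := by
    by_contra h
    exact h2 ⟨_, hId, hIr, h⟩
  refine ⟨j, hj, hinf, ?_⟩
  by_contra h
  exact h3 ⟨_, _, ⟨hId, hd⟩, ⟨hIinf, hinf⟩, h⟩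

lemma chemDist_le_of_notMem (hI : IpointSpec I) {ω : Config d} {u : Vert d} {J L N m : ℕ} {c : ℝ}
    (hN : ((J * dist1 u 0 : ℤ) : ℝ) ≤ Real.sqrt N) (h0 : ω ∉ nearBad u J L N)
    (h1 : shift (N • u) ω ∉ nearBad u J L N) (h2 : ω ∉ rayBad u c J N)
    (hm : L + ⌊(N + J) * c⌋₊ + L ≤ m) : chemDist ω (I ω 0 N) (I ω u N) ≤ m := by
  obtain ⟨j, hj, hinf, hd⟩ := hI.exists_infCluster_near h0 hN
  obtain ⟨j', hj', hinf', hd'⟩ := hI.exists_infCluster_near h1 hN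
  rw [infCluster_shift] at hinf'
  rw [ChemDist.chemDist_shift, hI.apply_shift, zero_add, chemDist_comm] at hd'
  have h3 : chemDist ω (j • u) (j' • u + N • u) ≤ (⌊(N + J) * c⌋₊ : ℕ) := by
    by_contra h
    exact h2 ⟨j, j', ⟨hj, hj'⟩, ⟨hinf, hinf'⟩, h⟩
  calc chemDist ω (I ω 0 N) (I ω u N)
      ≤ chemDist ω (I ω 0 N) (j' • u + N • u) + chemDist ω (j' • u + N • u) (I ω u N) :=
        chemDist_triangle _ _ _ _
    _ ≤ chemDist ω (I ω 0 N) (j • u) + chemDist ω (j • u) (j' • u + N • u) +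
          chemDist ω (j' • u + N • u) (I ω u N) := by
        gcongr
        exact chemDist_triangle _ _ _ _
    _ ≤ L + (⌊(N + J) * c⌋₊ : ℕ) + L := by gcongr
    _ ≤ m := by exact_mod_cast hm

/-- The regularised points at `0` and `u` are typically at chemical distance at most
`N μ(u) (1 + η)`. -/
theorem eventually_measureReal_lt (hI : IpointSpec I) {p : unitInterval} {μ : (Fin d → ℝ) → ℝ}
    (hμ : TimeConstant d p μ) (hp : 0 < (prodBern fun _ : EdgeT d => p).real {ω | InfCluster ω 0})
    {u : Vert d} (hu : u ≠ 0) {η : ℝ} (hη : 0 < η) {ε : ℝ} (hε : 0 < ε) :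
    ∀ᶠ N : ℕ in atTop, (prodBern fun _ : EdgeT d => p).real
      {ω | ¬ chemDist ω (I ω 0 N) (I ω u N) ≤ (⌊N * μ (toR u) * (1 + η)⌋₊ : ℕ)} < ε := by
  have hε3 : 0 < ε / 3 := by linarith
  have hμu := hμ.1.pos hu
  obtain ⟨J, L, hJL⟩ := hμ.exists_nearBad_lt hp hu hε3
  set c := μ (toR u) * (1 + η / 2) with hc
  have hμc : μ (toR u) < c := by rw [hc]; nlinarith
  have hsqrt : Tendsto (fun N : ℕ => Real.sqrt N) atTop atTop :=
    Real.tendsto_sqrt_atTop.comp tendsto_natCast_atTop_atTop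
  have hlin : Tendsto (fun N : ℕ => (N : ℝ) * (μ (toR u) * (η / 2))) atTop atTop :=
    tendsto_natCast_atTop_atTop.atTop_mul_const (by positivity)
  filter_upwards [hJL, (hμ.tendsto_rayBad hu hμc J).eventually (gt_mem_nhds hε3),
    hsqrt.eventually_ge_atTop ((J * dist1 u 0 : ℤ) : ℝ),
    hlin.eventually_ge_atTop (2 * L + J * c)] with N h1 h2 h3 h4
  have hm : L + ⌊(N + J) * c⌋₊ + L ≤ ⌊N * μ (toR u) * (1 + η)⌋₊ := by
    refine Nat.le_floor ?_
    have := Nat.floor_le (show 0 ≤ ((N : ℝ) + J) * c by positivity)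
    push_cast
    have e : (N : ℝ) * μ (toR u) * (1 + η) = N * c + N * (μ (toR u) * (η / 2)) := by
      rw [hc]; ring
    rw [e]
    linarith
  have hsub : {ω | ¬ chemDist ω (I ω 0 N) (I ω u N) ≤ (⌊N * μ (toR u) * (1 + η)⌋₊ : ℕ)} ⊆
      nearBad u J L N ∪ shift (N • u) ⁻¹' nearBad u J L N ∪ rayBad u c J N := by
    intro ω hω
    by_contra hcon
    simp only [Set.mem_union, not_or] at hcon
    exact hω (hI.chemDist_le_of_notMem h3 hcon.1.1 hcon.1.2 hcon.2 hm)
  have h5 := measureReal_preimage_le (measurePreserving_shift p (N • u)) (nearBad u J L N)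
  have h6 := measureReal_mono hsub (μ := prodBern fun _ : EdgeT d => p)
  have h7 := measureReal_union_le (μ := prodBern fun _ : EdgeT d => p)
    (nearBad u J L N ∪ shift (N • u) ⁻¹' nearBad u J L N) (rayBad u c J N)
  have h8 := measureReal_union_le (μ := prodBern fun _ : EdgeT d => p)
    (nearBad u J L N) (shift (N • u) ⁻¹' nearBad u J L N)
  linarith

end IpointSpec

end Typical

/-! ### The macroscopic field -/

section Macroscopic

open ProbabilityTheory

lemma exists_restrict_of_dependsOn {ι β : Type*} [Nonempty β] {X : (ι → Bool) → β} {F : Finset ι}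
    (hX : DependsOn X (F : Set ι)) : ∃ X' : (F → Bool) → β, X = fun ω => X' fun i => ω i := by
  classical
  refine ⟨fun b => X fun i => if h : i ∈ F then b ⟨i, h⟩ else false, funext fun ω => hX ?_⟩
  intro i hi
  rw [dif_pos (Finset.mem_coe.1 hi)]

lemma measurable_of_dependsOn {ι β : Type*} [Nonempty β] [MeasurableSpace β]
    {X : (ι → Bool) → β} {F : Finset ι} (hX : DependsOn X (F : Set ι)) : Measurable X := by
  obtain ⟨X', rfl⟩ := exists_restrict_of_dependsOn hX
  exact (measurable_of_finite X').comp (by fun_prop)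

lemma indepFun_of_dependsOn {ι β γ : Type*} [Nonempty β] [Nonempty γ] [MeasurableSpace β]
    [MeasurableSpace γ] (p : ι → unitInterval) {X : (ι → Bool) → β} {Y : (ι → Bool) → γ}
    {F G : Finset ι} (h : Disjoint F G) (hX : DependsOn X (F : Set ι))
    (hY : DependsOn Y (G : Set ι)) : IndepFun X Y (prodBern p) := by
  obtain ⟨X', rfl⟩ := exists_restrict_of_dependsOn hX
  obtain ⟨Y', rfl⟩ := exists_restrict_of_dependsOn hY
  exact (indepFun_restrict_prodBern p h).comp (measurable_of_finite X') (measurable_of_finite Y')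

lemma card_ballE_le {d : ℕ} (c : Vert d) (n : ℕ) :
    (ballE c n).card ≤ (ballE (0 : Vert d) n).card := by
  refine Finset.card_le_card_of_injOn (edgeMap (Equiv.addRight (-c)) (dist1_addRight (-c))) ?_
    (edgeMap_injective _ _).injOn
  intro e he
  rw [Finset.mem_coe, mem_ballE] at he ⊢
  intro x hx
  obtain ⟨v, hv, rfl⟩ := Sym2.mem_map.1 hx
  have := he v hv
  rwa [← dist1_add_right v c (-c), add_neg_cancel] at this

variable {d : ℕ}

lemma exists_tail (e : EdgeT d) : ∃ (a : Vert d) (i : Fin d), e.1 = s(a, a + Pi.single i 1) := by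
  obtain ⟨x, y, h, he⟩ := e.2
  have h : ∑ i, |x i - y i| = 1 := h
  obtain ⟨i, hi⟩ : ∃ i, |x i - y i| ≠ 0 := by
    by_contra hcon
    push Not at hcon
    simp [hcon] at h
  have hsplit := Finset.add_sum_erase Finset.univ (fun i => |x i - y i|) (Finset.mem_univ i)
  have hnn : ∀ j ∈ Finset.univ.erase i, 0 ≤ |x j - y j| := fun _ _ => abs_nonneg _
  have hsum := Finset.sum_nonneg hnn
  have hi0 := abs_nonneg (x i - y i)
  simp only [h] at hsplit
  have hi1 : |x i - y i| = 1 := by omega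
  have hj : ∀ j, j ≠ i → x j = y j := by
    intro j hji
    have h0 : ∑ j ∈ Finset.univ.erase i, |x j - y j| = 0 := by omega
    have := (Finset.sum_eq_zero_iff_of_nonneg hnn).1 h0 j (by simp [hji])
    exact sub_eq_zero.1 (abs_eq_zero.1 this)
  rcases (abs_eq zero_le_one).1 hi1 with h1 | h1
  · refine ⟨y, i, he.trans (Sym2.eq_swap.trans (congrArg (fun z => s(y, z)) (funext fun j => ?_)))⟩
    rcases eq_or_ne j i with rfl | hji
    · simp; omega
    · simp [hji, hj j hji]
  · refine ⟨x, i, he.trans (congrArg (fun z => s(x, z)) (funext fun j => ?_))⟩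
    rcases eq_or_ne j i with rfl | hji
    · simp; omega
    · simp [hji, hj j hji]

/-- The lower endpoint of an edge. -/
noncomputable def tail (e : EdgeT d) : Vert d := (exists_tail e).choose

/-- The direction of an edge. -/
noncomputable def dir (e : EdgeT d) : Fin d := (exists_tail e).choose_spec.choose

lemma eq_tail_dir (e : EdgeT d) : e.1 = s(tail e, tail e + Pi.single (dir e) 1) :=
  (exists_tail e).choose_spec.choose_spec

lemma lt_dist1_tail_of_notMem {e : EdgeT d} {c : Vert d} {k : ℕ} (h : e ∉ ballE c (k + 1)) :
    (k : ℤ) < dist1 (tail e) c := by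
  contrapose! h
  rw [mem_ballE, eq_tail_dir e]
  intro v hv
  rcases Sym2.mem_iff.1 hv with rfl | rfl
  · push_cast; omega
  · have h1 := dist1_triangle (tail e + Pi.single (dir e) 1) (tail e) c
    have h2 : dist1 (tail e + Pi.single (dir e) 1) (tail e) = 1 := by
      simp [dist1, Pi.single_apply, apply_ite abs]
    push_cast
    omega

section Lmap

variable (g : Fin d → Vert d → Vert d) (w : Vert d)

lemma Lmap_add_single (a : Vert d) (i : Fin d) :
    Lmap g w (a + Pi.single i 1) = g i w + Lmap g w a := by
  funext j
  simp [Lmap, add_mul, Finset.sum_add_distrib, Pi.single_apply, add_comm]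

lemma dist1_nsmul_Lmap (N : ℕ) (a b : Vert d) :
    ((dist1 (N • Lmap g w a) (N • Lmap g w b) : ℤ) : ℝ) =
      N * nrm1 (fun j => ∑ i, (toR a i - toR b i) * ((g i w j : ℤ) : ℝ)) := by
  simp only [dist1, nrm1, toR, Lmap, Pi.smul_apply, nsmul_eq_mul, Int.cast_sum, Int.cast_abs]
  rw [Finset.mul_sum]
  refine Finset.sum_congr rfl fun j _ => ?_
  push_cast
  rw [← mul_sub, abs_mul, Nat.abs_cast, ← Finset.sum_sub_distrib]
  simp only [sub_mul]

end Lmap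

variable {I : Config d → Vert d → ℕ → Vert d} {g : Fin d → Vert d → Vert d} {w : Vert d}

lemma Rfield_eq_true_iff {N : ℕ} {t : ℝ} (ht : 0 ≤ t) {ω : Config d} {e : EdgeT d} :
    Rfield I g w N t ω e = true ↔
      chemDist ω (I ω (Lmap g w (tail e)) N) (I ω (g (dir e) w + Lmap g w (tail e)) N) ≤
        (⌊t⌋₊ : ℕ) := by
  rw [← conn_and_chemDistR_le_iff ht, ← Lmap_add_single]
  simp only [Rfield, decide_eq_true_eq]
  refine ⟨fun h => h _ _ (eq_tail_dir e), fun h a b hab => ?_⟩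
  rw [eq_tail_dir e, Sym2.eq_iff] at hab
  rcases hab with ⟨rfl, rfl⟩ | ⟨rfl, rfl⟩
  · exact h
  · refine ⟨h.1.symm, ?_⟩
    rw [chemDistR, chemDist_comm]
    exact h.2

lemma nrm1_toR_sub (a b : Vert d) : nrm1 (fun i => toR a i - toR b i) = ((dist1 a b : ℤ) : ℝ) := by
  simp [nrm1, toR, dist1]

lemma IsSignedPermZ.sum_abs {f : Vert d → Vert d} (hf : IsSignedPermZ f) (w : Vert d) :
    dist1 (f w) 0 = dist1 w 0 := by
  rw [← hf.dist1_eq w 0, hf.map_zero]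

namespace IpointSpec

lemma dependsOn_Rfield (hI : IpointSpec I) {N : ℕ} {t : ℝ} (ht : 0 ≤ t) {M : ℕ}
    (hg : ∀ i, dist1 (g i w) 0 = M)
    (e : EdgeT d) :
    DependsOn (fun ω => Rfield I g w N t ω e)
      (ballE (N • Lmap g w (tail e)) (N + ⌊t⌋₊ + N * M) : Set (EdgeT d)) := by
  intro ω ω' h
  rw [Bool.eq_iff_iff, Rfield_eq_true_iff ht, Rfield_eq_true_iff ht]
  refine iff_of_eq (hI.dependsOn_chemDist_le _ _ N ⌊t⌋₊ fun e' he' => h e' ?_)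
  rw [Finset.mem_coe, Finset.mem_union] at he'
  rcases he' with he' | he'
  · refine ballE_subset ?_ he'
    rw [dist1_self]
    push_cast
    nlinarith
  · refine ballE_subset ?_ he'
    have h1 := dist1_nsmul_zero (g (dir e) w) N
    have h2 := dist1_add_right (N • g (dir e) w) 0 (N • Lmap g w (tail e))
    rw [zero_add] at h2
    rw [smul_add, h2, h1, hg]
    push_cast
    have : (0 : ℤ) ≤ (⌊t⌋₊ : ℤ) := by positivity
    linarith

lemma measurable_Rfield (hI : IpointSpec I) {N : ℕ} {t : ℝ} (ht : 0 ≤ t) {M : ℕ}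
    (hg : ∀ i, dist1 (g i w) 0 = M) :
    Measurable (Rfield I g w N t) :=
  measurable_pi_lambda _ fun e => measurable_of_dependsOn (hI.dependsOn_Rfield ht hg e)

lemma measureReal_Rfield_eq_false_le (hI : IpointSpec I) (p : unitInterval) {N : ℕ} {t : ℝ}
    (ht : 0 ≤ t)
    (e : EdgeT d) :
    (prodBern fun _ : EdgeT d => p).real {ω | Rfield I g w N t ω e = false} ≤
      (prodBern fun _ : EdgeT d => p).real
        {ω | ¬ chemDist ω (I ω 0 N) (I ω (g (dir e) w) N) ≤ (⌊t⌋₊ : ℕ)} := by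
  refine le_of_eq_of_le (congrArg _ ?_)
    (measureReal_preimage_le (measurePreserving_shift p (N • Lmap g w (tail e))) _)
  ext ω
  rw [Set.mem_preimage, Set.mem_ofPred_eq, Set.mem_ofPred_eq, hI.chemDist_shift, zero_add,
    ← Rfield_eq_true_iff ht, Bool.not_eq_true]

lemma indepFun_Rfield (hI : IpointSpec I) (p : unitInterval) {N : ℕ} (hN : 0 < N) {t : ℝ}
    (ht : 0 ≤ t) {M : ℕ}
    (hg : ∀ i, dist1 (g i w) 0 = M) {Cd : ℝ}
    (hL : ∀ y : Fin d → ℝ,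
      Cd * nrm1 y * M ≤ nrm1 (fun j => ∑ i, y i * ((g i w j : ℤ) : ℝ))) {k : ℕ}
    (hk : 2 * (N + t + N * M) ≤ N * (Cd * k * M)) {v : EdgeT d} {S : Finset (EdgeT d)}
    (hS : Disjoint S (ballE (tail v) (k + 1))) (hM : 0 < M) (hCd0 : 0 < Cd) :
    IndepFun (fun ω => Rfield I g w N t ω v) (fun ω (u : S) => Rfield I g w N t ω u)
      (prodBern fun _ : EdgeT d => p) := by
  classical
  set ρ := N + ⌊t⌋₊ + N * M
  refine indepFun_of_dependsOn _ (F := ballE (N • Lmap g w (tail v)) ρ)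
    (G := S.biUnion fun u => ballE (N • Lmap g w (tail u)) ρ) ?_ (hI.dependsOn_Rfield ht hg v) ?_
  · rw [Finset.disjoint_biUnion_right]
    intro u hu
    refine disjoint_ballE ?_
    have h1 := lt_dist1_tail_of_notMem (Finset.disjoint_left.1 hS hu)
    rw [dist1_comm] at h1
    have h2 := hL fun i => toR (tail v) i - toR (tail u) i
    rw [nrm1_toR_sub] at h2
    have h3 := dist1_nsmul_Lmap g w N (tail v) (tail u)
    have h4 : (ρ : ℝ) ≤ N + t + N * M := by
      have := Nat.floor_le ht
      simp only [ρ]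
      push_cast
      linarith
    have h5 : (k : ℝ) < ((dist1 (tail v) (tail u) : ℤ) : ℝ) := by exact_mod_cast h1
    have hN' : (0 : ℝ) < N := by exact_mod_cast hN
    have hM' : (0 : ℝ) < M := by exact_mod_cast hM
    have h6 : (N : ℝ) * (Cd * k * M) < N * (Cd * ((dist1 (tail v) (tail u) : ℤ) : ℝ) * M) := by
      gcongr
    have h7 := mul_le_mul_of_nonneg_left h2 hN'.le
    rw [← h3] at h7
    have h8 : ((ρ : ℝ) + ρ) <
        ((dist1 (N • Lmap g w (tail v)) (N • Lmap g w (tail u)) : ℤ) : ℝ) := by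
      linarith
    exact_mod_cast h8
  · intro ω ω' h
    funext u
    refine hI.dependsOn_Rfield ht hg u fun e he => h e ?_
    rw [Finset.coe_biUnion]
    exact Set.mem_biUnion u.2 he

end IpointSpec

lemma exists_tendsto_one {D : unitInterval → ℕ → Prop} (h0 : ∀ N, D 0 N)
    (h : ∀ r : ℝ, r < 1 → ∃ s : unitInterval, r ≤ s ∧ ∀ᶠ N in atTop, D s N) :
    ∃ q : ℕ → unitInterval, Tendsto (fun N => (q N : ℝ)) atTop (nhds 1) ∧ ∀ N, D (q N) N := by
  classical
  have h' : ∀ k : ℕ, ∃ s : unitInterval, (k : ℝ) / (k + 1) ≤ s ∧ (∀ᶠ N in atTop, D s N) ∧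
      (k = 0 → s = 0) := by
    intro k
    rcases eq_or_ne k 0 with rfl | hk
    · exact ⟨0, by simp, Eventually.of_forall h0, fun _ => rfl⟩
    · obtain ⟨s, hs, hD⟩ := h ((k : ℝ) / (k + 1))
        ((div_lt_one (by positivity)).2 (lt_add_one _))
      exact ⟨s, hs, hD, fun h => absurd h hk⟩
  choose s hs hD hs0 using h'
  set κ : ℕ → ℕ := fun N => Nat.findGreatest (fun k => D (s k) N) N
  have hκ : Tendsto κ atTop atTop := by
    rw [tendsto_atTop]
    intro K
    filter_upwards [hD K, eventually_ge_atTop K] with N hN hK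
    exact Nat.le_findGreatest hK hN
  refine ⟨fun N => s (κ N), ?_, fun N => ?_⟩
  · have h1 : Tendsto (fun k : ℕ => (k : ℝ) / (k + 1)) atTop (nhds 1) :=
      tendsto_natCast_div_add_atTop 1
    exact tendsto_of_tendsto_of_tendsto_of_le_of_le (h1.comp hκ) tendsto_const_nhds
      (fun N => hs (κ N)) fun N => (s (κ N)).2.2
  · exact Nat.findGreatest_spec (P := fun k => D (s k) N) (Nat.zero_le N)
      (by simpa only [hs0 0 rfl] using h0 N)

end Macroscopic

/-- **Domination for the macroscopic edge field** (Lemma 3.2 of Garet–Marchand).  There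
is `p̄ : ℕ → [0,1]`, independent of the direction `r̂ ∈ (1/M)ℤ^d ∩ 𝒮₁` (encoded here by
`w = M r̂ ∈ ℤ^d` with `‖w‖₁ = M`) with `p̄(N) → 1`, such that for every `N`, the law of
the field `(R^{N,r̂}_ē)_ē` — where the macroscopic edge `{x̄,ȳ}` is open when
`D(I^N_{L_{Mr̂}(x̄)}, I^N_{L_{Mr̂}(ȳ)}) ≤ N M μ(r̂)(1+η)` and `L_{Mr̂}` is given by
Lemma 2.1 — stochastically dominates `Ber(p̄(N))^{⊗𝔼^d}`. -/
theorem macroscopic_field_domination (d : ℕ) (hd : 2 ≤ d) (p : ℝ)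
    (hp : pc d < p) (hp1 : p ≤ 1) (μ : (Fin d → ℝ) → ℝ) (hμ : TimeConstant d p μ)
    (I : Config d → Vert d → ℕ → Vert d) (hI : IpointSpec I)
    (P : Measure (Config d)) (hP : IsProductBernoulli p P)
    (η : ℝ) (hη : 0 < η) (M : ℕ) (hM : 0 < M) (Cd : ℝ) (hCd : 0 < Cd) :
    ∃ pbar : ℕ → ℝ,
      (∀ N, pbar N ∈ Set.Icc (0 : ℝ) 1) ∧ Tendsto pbar atTop (nhds 1) ∧
      ∀ N : ℕ, 0 < N →
        ∀ (w : Vert d) (g : Fin d → Vert d → Vert d),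
          (∑ i, |w i|) = (M : ℤ) →
          g ⟨0, by omega⟩ = id →
          (∀ i, IsSignedPermZ (g i)) →
          (∀ y : Fin d → ℝ,
            Cd * nrm1 y * M ≤ nrm1 (fun j => ∑ i, y i * ((g i w j : ℤ) : ℝ))) →
          ∀ Q : Measure (Config d), IsProductBernoulli (pbar N) Q →
            ∀ f : Config d → ℝ, Measurable f → Monotone f →
              (∃ C : ℝ, ∀ ηc, |f ηc| ≤ C) →
              ∫ ηc, f ηc ∂Q ≤
                ∫ ω, f (Rfield I g w N
                  ((N : ℝ) * M * μ ((M : ℝ)⁻¹ • toR w) * (1 + η)) ω) ∂P := by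
  classical
  lift p to unitInterval using ⟨pc_nonneg.trans hp.le, hp1⟩
  obtain rfl := hP.eq_prodBern
  have hpos := infCluster_pos_of_pc_lt (by omega) hp
  have hM' : (0 : ℝ) < M := by exact_mod_cast hM
  have hfin : {u : Vert d | dist1 u 0 = M}.Finite :=
    (finite_dist1_le (0 : Vert d) M).subset fun u hu => le_of_eq hu
  have hne : ∀ u : Vert d, dist1 u 0 = M → u ≠ 0 := by
    rintro u hu rfl
    rw [dist1_self] at hu
    omega
  obtain ⟨K, hK⟩ := (hfin.image fun u => μ (toR u)).bddAbove
  have hK' : ∀ u : Vert d, dist1 u 0 = M → μ (toR u) ≤ K := fun u hu =>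
    hK (Set.mem_image_of_mem _ hu)
  obtain ⟨k, hk⟩ := exists_nat_ge (2 * (1 + K * (1 + η) + M) / (Cd * M))
  rw [div_le_iff₀ (by positivity)] at hk
  let D : unitInterval → ℕ → Prop := fun ρ N => 0 < N →
    ∀ (w : Vert d) (g : Fin d → Vert d → Vert d), dist1 w 0 = M →
      (∀ i, IsSignedPermZ (g i)) →
      (∀ y : Fin d → ℝ, Cd * nrm1 y * M ≤ nrm1 (fun j => ∑ i, y i * ((g i w j : ℤ) : ℝ))) →
      ∀ f : Config d → ℝ, Measurable f → Monotone f → (∃ C : ℝ, ∀ ηc, |f ηc| ≤ C) →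
        ∫ ηc, f ηc ∂(prodBern fun _ => ρ) ≤
          ∫ ω, f (Rfield I g w N (N * μ (toR w) * (1 + η)) ω) ∂(prodBern fun _ => p)
  have ht : ∀ (N : ℕ) (w : Vert d), 0 ≤ N * μ (toR w) * (1 + η) := fun N w =>
    mul_nonneg (mul_nonneg N.cast_nonneg (hμ.1.nonneg _)) (by linarith)
  have hg : ∀ {w : Vert d} {g : Fin d → Vert d → Vert d}, dist1 w 0 = M →
      (∀ i, IsSignedPermZ (g i)) → ∀ i, dist1 (g i w) 0 = M := fun hw hg i =>
    ((hg i).sum_abs _).trans hw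
  have hD0 : ∀ N, D 0 N := by
    intro N _ w g hw hgs _ f hf hmono ⟨C, hC⟩
    have hmeas := hI.measurable_Rfield (N := N) (ht N w) (hg hw hgs)
    have := Measure.isProbabilityMeasure_map (μ := prodBern fun _ : EdgeT d => p)
      hmeas.aemeasurable
    rw [← integral_map hmeas.aemeasurable hf.aestronglyMeasurable]
    refine integral_prodBern_le_of_cond (fun S v _ z => ?_) hf hmono hC
    simpa using measureReal_mono (Set.inter_subset_left)
  have hD : ∀ r : ℝ, r < 1 → ∃ s : unitInterval, r ≤ s ∧ ∀ᶠ N in atTop, D s N := by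
    intro r hr
    obtain ⟨r', hr', hr'1⟩ := exists_between (max_lt hr zero_lt_one)
    rw [max_lt_iff] at hr'
    have hs0 : 0 < √r' := Real.sqrt_pos.2 hr'.2
    have hs1 : √r' < 1 := by rw [Real.sqrt_lt' one_pos]; simpa using hr'1
    let s : unitInterval := ⟨√r', hs0.le, hs1.le⟩
    refine ⟨s * s, ?_, ?_⟩
    · change r ≤ √r' * √r'
      rw [Real.mul_self_sqrt hr'.2.le]
      exact hr'.1.le
    set Δ := (ballE (0 : Vert d) (k + 1)).card
    have hδ : 0 < (1 - √r') * (√r' * (1 - √r')) ^ Δ := by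
      have := sub_pos.2 hs1
      positivity
    have hev := (hfin.eventually_all (l := atTop)).2 fun u hu =>
      hI.eventually_measureReal_lt hμ hpos (hne u hu) hη hδ
    filter_upwards [hev] with N hN hN0 w g hw hgs hL f hf hmono ⟨C, hC⟩
    refine integral_prodBern_le_of_finiteRange (r := s) (nbr := fun v => ballE (tail v) (k + 1))
      (hI.measurable_Rfield (ht N w) (hg hw hgs)) (fun v => card_ballE_le _ _)
      (fun v S hS => hI.indepFun_Rfield p hN0 (ht N w) (hg hw hgs) hL ?_ hS hM hCd)
      (fun v => ?_) le_rfl hf hmono hC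
    · have h1 : (N : ℝ) * μ (toR w) * (1 + η) ≤ N * K * (1 + η) := by
        gcongr
        exact hK' w hw
      have h2 := mul_le_mul_of_nonneg_left hk N.cast_nonneg
      linarith
    · refine (hI.measureReal_Rfield_eq_false_le p (ht N w) v).trans ?_
      rw [← hμ.apply_signedPerm hpos (hgs (dir v)) w]
      exact (hN _ (hg hw hgs _)).le
  obtain ⟨q, hq, hDq⟩ := exists_tendsto_one hD0 hD
  refine ⟨fun N => q N, fun N => (q N).2, hq, fun N hN w g hw _ hgs hL Q hQ f hf hmono hC => ?_⟩
  obtain rfl := hQ.eq_prodBern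
  have hthr : (N : ℝ) * M * μ ((M : ℝ)⁻¹ • toR w) * (1 + η) = N * μ (toR w) * (1 + η) := by
    rw [hμ.1.smul, abs_of_pos (inv_pos.2 hM')]
    field_simp
  rw [hthr]
  exact hDq N hN w g (by simpa [dist1] using hw) hgs hL f hf hmono hC

end ChemDist
end
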